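/- arXiv:1708.08131 — 2 statements merged into one kernel-verified Lean document; each statement's English description precedes it below -/
import Mathlib

section
/- Let α ∈ (0,1], λ ∈ ℂ with |arg λ| > απ/2 (λ ≠ 0), and let f : [0,∞) → ℂ be continuous with f(t) → 0 as t → ∞. Then for every x₀ ∈ ℂ, the function φ(t) = x₀ E_α(λ t^α) + ∫₀ᵗ (t−τ)^{α−1} E_{α,α}(λ(t−τ)^α) f(τ) dτ satisfies φ(t) → 0 as t → ∞. -/
open Filter MeasureTheory

/-- Two-parameter Mittag-Leffler function. -/
noncomputable def ML (α β : ℝ) (z : ℂ) : ℂ :=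
  ∑' j : ℕ, z ^ j / ((Real.Gamma (α * j + β) : ℝ) : ℂ)

theorem gamma_lb (a y : ℝ) (ha : 0 ≤ a) (hy : 0 < y) :
    y ^ a * Real.exp (-y) ≤ Real.Gamma (a + 1) := by
  rw [Real.Gamma_eq_integral (by linarith), ← integral_exp_neg_Ioi y, ← integral_const_mul]
  have hi : IntegrableOn (fun x => Real.exp (-x) * x ^ (a + 1 - 1)) (Set.Ioi 0) :=
    Real.GammaIntegral_convergent (by linarith)
  calc _ ≤ ∫ x in Set.Ioi y, Real.exp (-x) * x ^ (a + 1 - 1) := by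
        apply setIntegral_mono_on
        · exact (integrableOn_exp_neg_Ioi y).const_mul _
        · exact hi.mono_set (Set.Ioi_subset_Ioi hy.le)
        · exact measurableSet_Ioi
        · intro x hx
          rw [mul_comm, add_sub_cancel_right]
          have : y ^ a ≤ x ^ a := Real.rpow_le_rpow hy.le (le_of_lt hx) ha
          have := Real.exp_pos (-x)
          gcongr
    _ ≤ _ := by
        apply setIntegral_mono_set hi
        · filter_upwards [self_mem_ae_restrict measurableSet_Ioi] with x hx
          have : 0 < x := hx
          simp only [Pi.zero_apply]
          positivity
        · exact (Set.Ioi_subset_Ioi hy.le).eventuallyLE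

theorem integrableOn_rpow_exp (a r : ℝ) (ha : 0 ≤ a) (hr : 0 < r) :
    IntegrableOn (fun t : ℝ => t ^ a * Real.exp (-(r * t))) (Set.Ioi 0) := by
  have := integrableOn_rpow_mul_exp_neg_mul_rpow (p := 1) (s := a) (b := r) (by linarith)
    one_pos hr
  simpa using this

theorem norm_lap (a t : ℝ) (s : ℂ) (ht : 0 < t) :
    ‖((t ^ a : ℝ) : ℂ) * Complex.exp (-(s * t))‖ = t ^ a * Real.exp (-(s.re * t)) := by
  rw [norm_mul, Complex.norm_exp, Complex.norm_real, Real.norm_of_nonneg (by positivity)]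
  simp

theorem integrableOn_lap (a : ℝ) (s : ℂ) (ha : 0 ≤ a) (hs : 0 < s.re) :
    IntegrableOn (fun t : ℝ => ((t ^ a : ℝ) : ℂ) * Complex.exp (-(s * t))) (Set.Ioi 0) := by
  refine (integrableOn_rpow_exp a s.re ha hs).mono' ?_ ?_
  · have : Measurable (fun t : ℝ => ((t ^ a : ℝ) : ℂ) * Complex.exp (-(s * t))) := by fun_prop
    exact this.aestronglyMeasurable
  · filter_upwards [self_mem_ae_restrict measurableSet_Ioi] with x hx
    rw [norm_lap a x s hx]

theorem differentiableAt_lap (a : ℝ) (s : ℂ) (ha : 0 ≤ a) (hs : 0 < s.re) :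
    DifferentiableAt ℂ (fun s : ℂ => ∫ t : ℝ in Set.Ioi 0,
      ((t ^ a : ℝ) : ℂ) * Complex.exp (-(s * t))) s := by
  have hopen : IsOpen {z : ℂ | s.re / 2 < z.re} := isOpen_lt continuous_const Complex.continuous_re
  refine (hasDerivAt_integral_of_dominated_loc_of_deriv_le
    (F := fun (s : ℂ) (t : ℝ) => ((t ^ a : ℝ) : ℂ) * Complex.exp (-(s * t)))
    (F' := fun (s : ℂ) (t : ℝ) => ((t ^ a : ℝ) : ℂ) * (Complex.exp (-(s * t)) * (-t)))
    (bound := fun t => t ^ (a + 1) * Real.exp (-(s.re / 2 * t)))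
    (hopen.mem_nhds (show s.re / 2 < s.re by linarith)) ?_ (integrableOn_lap a s ha hs) ?_ ?_
    (integrableOn_rpow_exp (a + 1) (s.re / 2) (by linarith) (by linarith)) ?_).2.differentiableAt
  · refine Eventually.of_forall fun x => ?_
    have : Measurable (fun t : ℝ => ((t ^ a : ℝ) : ℂ) * Complex.exp (-(x * t))) := by fun_prop
    exact this.aestronglyMeasurable
  · have : Measurable (fun t : ℝ => ((t ^ a : ℝ) : ℂ) * (Complex.exp (-(s * t)) * (-t))) := by
      fun_prop
    exact this.aestronglyMeasurable
  · filter_upwards [self_mem_ae_restrict measurableSet_Ioi] with t ht x hx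
    have ht : 0 < t := ht
    have hx : s.re / 2 < x.re := hx
    rw [← mul_assoc, norm_mul, norm_lap a t x ht, norm_neg, Complex.norm_real,
      Real.norm_of_nonneg ht.le, Real.rpow_add ht, Real.rpow_one]
    have : Real.exp (-(x.re * t)) ≤ Real.exp (-(s.re / 2 * t)) := by
      apply Real.exp_le_exp.2
      nlinarith
    have h2 : 0 ≤ t ^ a := by positivity
    calc _ = t ^ a * t * Real.exp (-(x.re * t)) := by ring
      _ ≤ _ := by gcongr
  · filter_upwards [self_mem_ae_restrict measurableSet_Ioi] with t ht x hx
    have h1 : HasDerivAt (fun x : ℂ => -(x * t)) (-(t : ℂ)) x := by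
      have := ((hasDerivAt_id x).mul_const (t : ℂ)).neg
      rw [one_mul] at this
      exact this
    exact (h1.cexp).const_mul _

theorem laplace_rpow (a : ℝ) (s : ℂ) (ha : 0 ≤ a) (hs : 0 < s.re) :
    ∫ t : ℝ in Set.Ioi 0, ((t ^ a : ℝ) : ℂ) * Complex.exp (-(s * t)) =
      s ^ (-((a : ℂ) + 1)) * (Real.Gamma (a + 1) : ℂ) := by
  have hopen : IsOpen {z : ℂ | 0 < z.re} := isOpen_lt continuous_const Complex.continuous_re
  have h1 : AnalyticOnNhd ℂ (fun s : ℂ => ∫ t : ℝ in Set.Ioi 0,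
      ((t ^ a : ℝ) : ℂ) * Complex.exp (-(s * t))) {z : ℂ | 0 < z.re} := by
    apply DifferentiableOn.analyticOnNhd _ hopen
    intro z hz
    exact (differentiableAt_lap a z ha hz).differentiableWithinAt
  have h2 : AnalyticOnNhd ℂ (fun s : ℂ => s ^ (-((a : ℂ) + 1)) * (Real.Gamma (a + 1) : ℂ))
      {z : ℂ | 0 < z.re} := by
    apply DifferentiableOn.analyticOnNhd _ hopen
    intro z hz
    have : z ∈ Complex.slitPlane := Or.inl hz
    exact ((differentiableAt_id.cpow_const this).mul_const _).differentiableWithinAt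
  have hreal : ∀ r : ℝ, 0 < r → ∫ t : ℝ in Set.Ioi 0, ((t ^ a : ℝ) : ℂ) *
      Complex.exp (-((r : ℂ) * t)) = (r : ℂ) ^ (-((a : ℂ) + 1)) * (Real.Gamma (a + 1) : ℂ) := by
    intro r hr
    have := Complex.integral_cpow_mul_exp_neg_mul_Ioi (a := (a : ℂ) + 1) (r := r)
      (by simp; linarith) hr
    rw [Complex.cpow_neg, ← Complex.inv_cpow, ← one_div, ← Complex.Gamma_ofReal]
    · convert this using 1
      · apply setIntegral_congr_fun measurableSet_Ioi
        intro t ht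
        have ht : 0 < t := ht
        simp only [add_sub_cancel_right]
        rw [Complex.ofReal_cpow ht.le]
      · push_cast; rfl
    · rw [Complex.arg_ofReal_of_nonneg hr.le]; exact Real.pi_pos.ne
  refine h1.eqOn_of_preconnected_of_frequently_eq h2
    (convex_halfSpace_re_gt 0).isPreconnected (z₀ := 1) (by simp) ?_ hs
  have : Tendsto (fun n : ℕ => (((1 : ℝ) + 1 / ((n : ℝ) + 1) : ℝ) : ℂ)) atTop
      (nhdsWithin 1 {1}ᶜ) := by
    refine tendsto_nhdsWithin_iff.2 ⟨?_, ?_⟩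
    · have := (tendsto_const_nhds (x := (1 : ℝ))).add (tendsto_one_div_add_atTop_nhds_zero_nat (𝕜 := ℝ))
      have := (Complex.continuous_ofReal.tendsto _).comp this
      simpa [Function.comp_def] using this
    · refine Eventually.of_forall fun n => ?_
      have : (0 : ℝ) < 1 / ((n : ℝ) + 1) := by positivity
      intro h
      have h' := Complex.ofReal_injective ((Set.mem_singleton_iff.1 h).trans Complex.ofReal_one.symm)
      linarith
  refine this.frequently (Frequently.of_forall fun n => ?_)
  exact hreal _ (by positivity)

/-- Weighted Mittag-Leffler type series. -/
noncomputable def useries (α : ℝ) (lam : ℂ) (c : ℕ → ℝ) (t : ℝ) : ℂ :=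
  ∑' j : ℕ, (c j : ℂ) * lam ^ j *
    (((max t 0) ^ (α * j + 1) / Real.Gamma (α * j + 2) : ℝ) : ℂ)

theorem summable_c (c : ℕ → ℝ) (hc : ∀ j, |c j| ≤ ((j : ℝ) + 1) ^ 2) (ρ : ℝ) (hρ0 : 0 ≤ ρ)
    (hρ : ρ < 1) : Summable fun j : ℕ => |c j| * ρ ^ j := by
  have hn : ‖ρ‖ < 1 := by rwa [Real.norm_of_nonneg hρ0]
  have h2 := summable_pow_mul_geometric_of_norm_lt_one 2 hn
  have h1 := summable_pow_mul_geometric_of_norm_lt_one 1 hn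
  have h0 := summable_pow_mul_geometric_of_norm_lt_one 0 hn
  refine Summable.of_nonneg_of_le (fun j => by positivity) (fun j => ?_)
    ((h2.add (h1.mul_left 2)).add h0)
  calc _ ≤ ((j : ℝ) + 1) ^ 2 * ρ ^ j := by gcongr; exact hc j
    _ = _ := by ring

theorem rpow_lin (α σ : ℝ) (L : ℝ) (hσ : 0 < σ) (j : ℕ) (b : ℝ) :
    L ^ j * σ ^ (-(α * j + b)) = (L * σ ^ (-α)) ^ j * σ ^ (-b) := by
  rw [mul_pow, ← Real.rpow_natCast (σ ^ (-α)), ← Real.rpow_mul hσ.le, mul_assoc,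
    ← Real.rpow_add hσ]
  congr 2
  ring

theorem term_bound (a σ t : ℝ) (ha : 0 < a) (hσ : 0 < σ) :
    (max t 0) ^ a / Real.Gamma (a + 1) * Real.exp (-(σ * t)) ≤ σ ^ (-a) := by
  have hG : 0 < Real.Gamma (a + 1) := Real.Gamma_pos_of_pos (by linarith)
  rcases le_or_gt t 0 with h | h
  · rw [max_eq_right h, Real.zero_rpow ha.ne']
    simp only [zero_div, zero_mul]
    positivity
  · rw [max_eq_left h.le]
    have := gamma_lb a (σ * t) ha.le (by positivity)
    rw [Real.mul_rpow hσ.le h.le] at this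
    rw [Real.rpow_neg hσ.le, div_mul_eq_mul_div, div_le_iff₀ hG, inv_mul_eq_div,
      le_div_iff₀ (by positivity)]
    linarith

theorem u_inversion (α : ℝ) (hα : 0 < α) (lam : ℂ) (c : ℕ → ℝ)
    (hc : ∀ j, |c j| ≤ ((j : ℝ) + 1) ^ 2) (σ : ℝ) (hσ : 0 < σ) (hρ : ‖lam‖ * σ ^ (-α) < 1)
    (U : ℂ → ℂ)
    (hU : ∀ s : ℂ, s.re = σ →
      HasSum (fun j : ℕ => (c j : ℂ) * lam ^ j * s ^ (-((α * j + 2 : ℝ) : ℂ))) (U s))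
    (hUi : Integrable fun y : ℝ => U (σ + y * Complex.I)) :
    Continuous (useries α lam c) ∧ ∀ t : ℝ,
    useries α lam c t = (1 / (2 * Real.pi) : ℝ) *
      ∫ y : ℝ, Complex.exp ((σ + y * Complex.I) * t) * U (σ + y * Complex.I) := by
  have hG : ∀ j : ℕ, 0 < Real.Gamma (α * j + 2) := fun j =>
    Real.Gamma_pos_of_pos (by positivity)
  have haj : ∀ j : ℕ, 0 < α * j + 1 := fun j => by positivity
  set F : ℕ → ℝ → ℂ := fun j t => (c j : ℂ) * lam ^ j *
    (((max t 0) ^ (α * j + 1) / Real.Gamma (α * j + 2) * Real.exp (-(σ * t)) : ℝ) : ℂ) with hF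
  have hFu : ∀ t, ∑' j, F j t = useries α lam c t * Real.exp (-(σ * t)) := by
    intro t
    rw [useries, ← tsum_mul_right]
    refine tsum_congr fun j => ?_
    simp only [hF]; push_cast; ring
  have hFcont : ∀ j, Continuous (F j) := by
    intro j
    have h1 : Continuous fun t : ℝ => (max t 0) ^ (α * j + 1) :=
      (continuous_id.max continuous_const).rpow_const fun t => Or.inr (haj j).le
    have h2 : Continuous fun t : ℝ =>
      (max t 0) ^ (α * j + 1) / Real.Gamma (α * j + 2) * Real.exp (-(σ * t)) := by
      apply (h1.div_const _).mul
      fun_prop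
    exact continuous_const.mul (Complex.continuous_ofReal.comp h2)
  have hFnorm : ∀ j t, ‖F j t‖ = |c j| * ‖lam‖ ^ j * 
      ((max t 0) ^ (α * j + 1) / Real.Gamma (α * j + 2) * Real.exp (-(σ * t))) := by
    intro j t
    have := hG j
    simp only [hF]
    rw [norm_mul, norm_mul, norm_pow, Complex.norm_real, Complex.norm_real, Real.norm_eq_abs,
      Real.norm_of_nonneg (by positivity)]
  have hρ0 : 0 ≤ ‖lam‖ * σ ^ (-α) := by positivity
  have hsum := summable_c c hc _ hρ0 hρ
  have hcont : Continuous fun t => ∑' j, F j t := by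
    refine continuous_tsum hFcont (hsum.mul_right (σ ^ (-(1 : ℝ)))) ?_
    intro j t
    rw [hFnorm, mul_assoc, mul_assoc, ← rpow_lin α σ _ hσ j 1]
    gcongr
    have := term_bound (α * j + 1) σ t (haj j) hσ
    rwa [show α * (j : ℝ) + 1 + 1 = α * j + 2 by ring] at this
  -- integrals over `Ioi 0`
  have hzero : ∀ j t, t ∉ Set.Ioi (0 : ℝ) → F j t = 0 := by
    intro j t ht
    have ht : t ≤ 0 := not_lt.1 ht
    simp only [hF]
    rw [max_eq_right ht, Real.zero_rpow (haj j).ne']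
    simp
  have hlapF : ∀ (w : ℝ) j, ∀ t ∈ Set.Ioi (0 : ℝ), 
      Complex.exp (((-2 * Real.pi * t * w : ℝ) : ℂ) * Complex.I) * F j t =
      ((c j : ℂ) * lam ^ j / (Real.Gamma (α * j + 2) : ℂ)) * (((t ^ (α * j + 1) : ℝ) : ℂ) *
      Complex.exp (-((σ + (2 * Real.pi * w : ℝ) * Complex.I) * t))) := by
    intro w j t ht
    have ht : 0 < t := ht
    simp only [hF]
    rw [max_eq_left ht.le, show -(((σ : ℂ) + (2 * Real.pi * w : ℝ) * Complex.I) * t) =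
      ((-2 * Real.pi * t * w : ℝ) : ℂ) * Complex.I + ((-(σ * t) : ℝ) : ℂ) by push_cast; ring,
      Complex.exp_add]
    push_cast
    ring
  have hre : ∀ w : ℝ, ((σ : ℂ) + (w : ℝ) * Complex.I).re = σ := by intro w; simp
  have hExpInt : ∀ (w : ℝ) j, Integrable fun t : ℝ => 
      Complex.exp (((-2 * Real.pi * t * w : ℝ) : ℂ) * Complex.I) * F j t := by
    intro w j
    rw [← integrableOn_iff_integrable_of_support_subset (s := Set.Ioi (0 : ℝ))]
    · rw [integrableOn_congr_fun (hlapF w j) measurableSet_Ioi]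
      exact (integrableOn_lap (α * j + 1) _ (haj j).le (by rw [hre]; exact hσ)).const_mul _
    · intro t ht
      by_contra h
      exact ht (by simp only [hzero j t h, mul_zero])
  have hintF : ∀ j, Integrable (F j) := by
    intro j
    simpa using hExpInt 0 j
  have hval : ∀ (w : ℝ) j, ∫ t : ℝ,
      Complex.exp (((-2 * Real.pi * t * w : ℝ) : ℂ) * Complex.I) * F j t =
      (c j : ℂ) * lam ^ j * ((σ : ℂ) + (2 * Real.pi * w : ℝ) * Complex.I) ^
        (-((α * j + 2 : ℝ) : ℂ)) := by
    intro w j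
    rw [← setIntegral_eq_integral_of_forall_compl_eq_zero (s := Set.Ioi (0 : ℝ))
      (fun t ht => by rw [hzero j t ht, mul_zero]),
      setIntegral_congr_fun measurableSet_Ioi (hlapF w j), integral_const_mul,
      laplace_rpow (α * j + 1) _ (haj j).le (by rw [hre]; exact hσ)]
    have h2 : ((Real.Gamma (α * j + 2) : ℝ) : ℂ) ≠ 0 := by exact_mod_cast (hG j).ne'
    rw [show α * (j : ℝ) + 1 + 1 = α * j + 2 by ring, show (-(((α * (j : ℝ) + 1 : ℝ) : ℂ) + 1)) =
      (-((α * j + 2 : ℝ) : ℂ)) by push_cast; ring]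
    field_simp
  have hnormint : ∀ j, ∫ t : ℝ, ‖F j t‖ = |c j| * (‖lam‖ * σ ^ (-α)) ^ j * σ ^ (-(2 : ℝ)) := by
    intro j
    rw [← setIntegral_eq_integral_of_forall_compl_eq_zero (s := Set.Ioi (0 : ℝ))
      (fun t ht => by rw [hzero j t ht, norm_zero])]
    have : ∀ t ∈ Set.Ioi (0 : ℝ), ‖F j t‖ = |c j| * ‖lam‖ ^ j / Real.Gamma (α * j + 2) *
        (t ^ (α * j + 2 - 1) * Real.exp (-(σ * t))) := by
      intro t ht
      have ht : 0 < t := ht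
      rw [hFnorm, max_eq_left ht.le, show α * (j : ℝ) + 2 - 1 = α * j + 1 by ring]
      ring
    rw [setIntegral_congr_fun measurableSet_Ioi this, integral_const_mul,
      Real.integral_rpow_mul_exp_neg_mul_Ioi (by positivity) hσ, mul_assoc, ← rpow_lin α σ _ hσ j 2,
      one_div, Real.inv_rpow hσ.le, ← Real.rpow_neg hσ.le]
    have := (hG j).ne'
    field_simp
  have hsumint : Summable fun j => ∫ t : ℝ, ‖F j t‖ := by
    simp_rw [hnormint]
    exact hsum.mul_right _
  have hTotInt : Integrable fun t => ∑' j, F j t := by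
    refine ⟨hcont.aestronglyMeasurable, ?_⟩
    have h1 : ∫⁻ t, ‖∑' j, F j t‖ₑ ≤ ∫⁻ t, ∑' j, ‖F j t‖ₑ :=
      lintegral_mono fun t => enorm_tsum_le_tsum_enorm
    rw [lintegral_tsum fun j => (hFcont j).enorm.measurable.aemeasurable] at h1
    simp_rw [← fun j => ofReal_integral_norm_eq_lintegral_enorm (hintF j)] at h1
    exact lt_of_le_of_lt h1 hsumint.tsum_ofReal_lt_top
  have hfour : ∀ w : ℝ, FourierTransform.fourier (fun t => ∑' j, F j t) w =
      U (σ + (2 * Real.pi * w : ℝ) * Complex.I) := by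
    intro w
    rw [Real.fourier_real_eq_integral_exp_smul]
    have h1 := hasSum_integral_of_summable_integral_norm (hExpInt w) (by
      have h0 : ∀ j (t : ℝ), ‖Complex.exp (((-2 * Real.pi * t * w : ℝ) : ℂ) * Complex.I) * F j t‖ =
          ‖F j t‖ := by
        intro j t
        rw [norm_mul, Complex.norm_exp_ofReal_mul_I, one_mul]
      simp_rw [h0]
      exact hsumint)
    simp_rw [hval] at h1
    rw [← (h1.unique (hU _ (hre _)))]
    congr 1
    ext t
    rw [smul_eq_mul, tsum_mul_left]
  have hfourint : Integrable (FourierTransform.fourier (fun t => ∑' j, F j t)) := by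
    have : FourierTransform.fourier (fun t => ∑' j, F j t) =
      fun w : ℝ => U (σ + (2 * Real.pi * w : ℝ) * Complex.I) := funext hfour
    rw [this]
    exact hUi.comp_mul_left' (g := fun y : ℝ => U (σ + y * Complex.I)) (R := 2 * Real.pi)
      (by positivity)
  have hu : ∀ t, useries α lam c t = (∑' j, F j t) * Complex.exp (σ * t) := by
    intro t
    rw [hFu, mul_assoc]
    push_cast
    rw [← Complex.exp_add]
    simp
  refine ⟨?_, fun t => ?_⟩
  · rw [funext hu]
    apply hcont.mul
    fun_prop
  · rw [hu, ← hTotInt.fourierInv_fourier_eq hfourint hcont.continuousAt, Real.fourierInv_eq',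
      ← integral_mul_const]
    have h2 := Measure.integral_comp_mul_left
      (fun y : ℝ => Complex.exp ((σ + y * Complex.I) * t) * U (σ + y * Complex.I)) (2 * Real.pi)
    have hpi := Real.pi_pos
    rw [abs_of_pos (by positivity), ← one_div, Complex.real_smul] at h2
    rw [← h2]
    congr 1
    ext w
    rw [hfour, smul_eq_mul, mul_right_comm, ← Complex.exp_add]
    congr 2
    simp
    ring

theorem norm_vert (γ c y : ℝ) (hc : 0 < c) :
    ‖(c : ℂ) + y * Complex.I‖ ^ (γ - 2) =
      c ^ (γ - 2) * (1 + ‖c⁻¹ * y‖ ^ 2) ^ (-(2 - γ) / 2) := by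
  have h1 : ‖(c : ℂ) + y * Complex.I‖ = c * (1 + ‖c⁻¹ * y‖ ^ 2) ^ ((1 : ℝ) / 2) := by
    rw [Complex.norm_add_mul_I, ← Real.sqrt_eq_rpow, Real.norm_eq_abs, sq_abs]
    rw [show c ^ 2 + y ^ 2 = c ^ 2 * (1 + (c⁻¹ * y) ^ 2) by field_simp,
      Real.sqrt_mul (by positivity), Real.sqrt_sq hc.le]
  rw [h1, Real.mul_rpow hc.le (by positivity), ← Real.rpow_mul (by positivity)]
  congr 2
  ring

theorem integrable_vert (γ c : ℝ) (hγ1 : γ < 1) (hc : 0 < c) :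
    Integrable fun y : ℝ => ‖(c : ℂ) + y * Complex.I‖ ^ (γ - 2) := by
  simp_rw [norm_vert γ c _ hc]
  have h : Integrable fun y : ℝ => (1 + ‖y‖ ^ 2) ^ (-(2 - γ) / 2) :=
    integrable_rpow_neg_one_add_norm_sq (by simp; linarith)
  exact (h.comp_mul_left' (inv_pos.2 hc).ne').const_mul _

theorem integral_vert (γ c : ℝ) (hc : 0 < c) :
    ∫ y : ℝ, ‖(c : ℂ) + y * Complex.I‖ ^ (γ - 2) =
      c ^ (γ - 1) * ∫ y : ℝ, (1 + ‖y‖ ^ 2) ^ (-(2 - γ) / 2) := by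
  simp_rw [norm_vert γ c _ hc]
  rw [integral_const_mul,
    Measure.integral_comp_mul_left (fun y : ℝ => (1 + ‖y‖ ^ 2) ^ (-(2 - γ) / 2)) c⁻¹,
    inv_inv, abs_of_pos hc, smul_eq_mul, ← mul_assoc]
  congr 1
  rw [show γ - 1 = γ - 2 + 1 by ring, Real.rpow_add hc, Real.rpow_one]

theorem cont_vert (U : ℂ → ℂ) (hU : DifferentiableOn ℂ U {z : ℂ | 0 < z.re}) (c : ℝ)
    (hc : 0 < c) : Continuous fun y : ℝ => U (c + y * Complex.I) := by
  refine hU.continuousOn.comp_continuous (by fun_prop) ?_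
  intro y
  simpa using hc

theorem integrable_U (U : ℂ → ℂ) (hU : DifferentiableOn ℂ U {z : ℂ | 0 < z.re}) (C γ : ℝ)
    (hγ1 : γ < 1) (hb : ∀ s : ℂ, 0 < s.re → ‖U s‖ ≤ C * ‖s‖ ^ (γ - 2)) (c : ℝ) (hc : 0 < c) :
    Integrable fun y : ℝ => U (c + y * Complex.I) := by
  refine ((integrable_vert γ c hγ1 hc).const_mul C).mono'
    (cont_vert U hU c hc).aestronglyMeasurable (Eventually.of_forall fun y => ?_)
  exact hb _ (by simpa using hc)

theorem norm_exp_vert (c y t : ℝ) : ‖Complex.exp ((c + y * Complex.I) * t)‖ = Real.exp (c * t) := by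
  rw [Complex.norm_exp]; simp

theorem integrable_expU (U : ℂ → ℂ) (hU : DifferentiableOn ℂ U {z : ℂ | 0 < z.re}) (C γ : ℝ)
    (hγ1 : γ < 1) (hb : ∀ s : ℂ, 0 < s.re → ‖U s‖ ≤ C * ‖s‖ ^ (γ - 2)) (c t : ℝ) (hc : 0 < c) :
    Integrable fun y : ℝ => Complex.exp ((c + y * Complex.I) * t) * U (c + y * Complex.I) := by
  refine ((integrable_U U hU C γ hγ1 hb c hc).norm.const_mul (Real.exp (c * t))).mono'
    (Continuous.aestronglyMeasurable ?_) (Eventually.of_forall fun y => ?_)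
  · exact Continuous.mul (by fun_prop) (cont_vert U hU c hc)
  · rw [norm_mul, norm_exp_vert]

theorem shift_line (U : ℂ → ℂ) (hU : DifferentiableOn ℂ U {z : ℂ | 0 < z.re}) (C γ : ℝ)
    (hC : 0 ≤ C) (hγ1 : γ < 1)
    (hb : ∀ s : ℂ, 0 < s.re → ‖U s‖ ≤ C * ‖s‖ ^ (γ - 2)) (c σ t : ℝ) (hc : 0 < c)
    (hcσ : c ≤ σ) (ht : 0 ≤ t) :
    ∫ y : ℝ, Complex.exp ((σ + y * Complex.I) * t) * U (σ + y * Complex.I) =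
    ∫ y : ℝ, Complex.exp ((c + y * Complex.I) * t) * U (c + y * Complex.I) := by
  set F : ℂ → ℂ := fun s => Complex.exp (s * t) * U s with hF
  have hσ : 0 < σ := hc.trans_le hcσ
  have hi1 := integrable_expU U hU C γ hγ1 hb σ t hσ
  have hi2 := integrable_expU U hU C γ hγ1 hb c t hc
  have l1 := intervalIntegral_tendsto_integral hi1 tendsto_neg_atTop_atBot tendsto_id
  have l2 := intervalIntegral_tendsto_integral hi2 tendsto_neg_atTop_atBot tendsto_id
  have hFd : DifferentiableOn ℂ F {z : ℂ | 0 < z.re} := by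
    apply DifferentiableOn.mul _ hU
    fun_prop
  have hbd : ∀ (T : ℝ), T ≠ 0 → ‖∫ x : ℝ in c..σ, F (x + (T : ℝ) * Complex.I)‖ ≤
      Real.exp (σ * t) * (C * |T| ^ (γ - 2)) * |σ - c| := by
    intro T hT
    apply intervalIntegral.norm_integral_le_of_norm_le_const
    intro x hx
    rw [Set.uIoc_of_le hcσ] at hx
    have hx0 : 0 < x := hc.trans hx.1
    simp only [hF]
    rw [norm_mul, norm_exp_vert]
    have h1 : |T| ≤ ‖(x : ℂ) + T * Complex.I‖ := by
      have := Complex.abs_im_le_norm ((x : ℂ) + T * Complex.I)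
      simpa using this
    have h2 : ‖(x : ℂ) + T * Complex.I‖ ^ (γ - 2) ≤ |T| ^ (γ - 2) :=
      Real.rpow_le_rpow_of_nonpos (abs_pos.2 hT) h1 (by linarith)
    have h3 := hb ((x : ℂ) + T * Complex.I) (by simpa using hx0)
    have h4 : Real.exp (x * t) ≤ Real.exp (σ * t) := by
      apply Real.exp_le_exp.2
      exact mul_le_mul_of_nonneg_right hx.2 ht
    have h5 : ‖U ((x : ℂ) + T * Complex.I)‖ ≤ C * |T| ^ (γ - 2) := h3.trans (by gcongr)
    gcongr
  have hlim : Tendsto (fun T : ℝ => Real.exp (σ * t) * (C * |T| ^ (γ - 2)) * |σ - c|) atTop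
      (nhds 0) := by
    have h1 : Tendsto (fun T : ℝ => |T| ^ (γ - 2)) atTop (nhds 0) := by
      have := (tendsto_rpow_neg_atTop (y := 2 - γ) (by linarith)).comp tendsto_abs_atTop_atTop
      simpa [Function.comp_def] using this
    simpa using ((h1.const_mul C).const_mul (Real.exp (σ * t))).mul_const |σ - c|
  have z1 : Tendsto (fun T : ℝ => ∫ x : ℝ in c..σ, F (x + (T : ℝ) * Complex.I)) atTop (nhds 0) := by
    refine squeeze_zero_norm' ?_ hlim
    filter_upwards [eventually_gt_atTop 0] with T hT
    exact hbd T hT.ne'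
  have z2 : Tendsto (fun T : ℝ => ∫ x : ℝ in c..σ, F (x + (-T : ℝ) * Complex.I)) atTop
      (nhds 0) := by
    refine squeeze_zero_norm' ?_ hlim
    filter_upwards [eventually_gt_atTop 0] with T hT
    have := hbd (-T) (by linarith)
    rwa [abs_neg] at this
  have hrect : ∀ T : ℝ, (((∫ x : ℝ in c..σ, F (x + (-T : ℝ) * Complex.I)) -
      ∫ x : ℝ in c..σ, F (x + (T : ℝ) * Complex.I)) +
      Complex.I • ∫ y : ℝ in (-T)..T, F (σ + y * Complex.I)) -
      Complex.I • ∫ y : ℝ in (-T)..T, F (c + y * Complex.I) = 0 := by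
    intro T
    have := Complex.integral_boundary_rect_eq_zero_of_differentiableOn F ⟨c, -T⟩ ⟨σ, T⟩ (by
      refine hFd.mono ?_
      intro z hz
      have := (Complex.mem_reProdIm.1 hz).1
      simp only at this
      rw [Set.uIcc_of_le hcσ] at this
      exact hc.trans_le this.1)
    exact this
  have hl := ((z2.sub z1).add (l1.const_smul Complex.I)).sub (l2.const_smul Complex.I)
  have h0 := tendsto_nhds_unique (hl.congr hrect) tendsto_const_nhds
  rw [sub_zero, zero_add, sub_eq_zero, smul_eq_mul, smul_eq_mul] at h0
  exact mul_left_cancel₀ Complex.I_ne_zero h0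

theorem line_bound (U : ℂ → ℂ) (hU : DifferentiableOn ℂ U {z : ℂ | 0 < z.re}) (C γ : ℝ)
    (hC : 0 ≤ C) (hγ1 : γ < 1)
    (hb : ∀ s : ℂ, 0 < s.re → ‖U s‖ ≤ C * ‖s‖ ^ (γ - 2)) (σ : ℝ) (hσ : 0 < σ) :
    ∃ D : ℝ, ∀ t : ℝ, 1 / σ ≤ t →
    ‖∫ y : ℝ, Complex.exp ((σ + y * Complex.I) * t) * U (σ + y * Complex.I)‖ ≤
      D * t ^ (1 - γ) := by
  refine ⟨Real.exp 1 * (C * ∫ y : ℝ, (1 + ‖y‖ ^ 2) ^ (-(2 - γ) / 2)), fun t ht => ?_⟩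
  have ht0 : 0 < t := lt_of_lt_of_le (by positivity) ht
  have hc : 0 < t⁻¹ := inv_pos.2 ht0
  have hcσ : t⁻¹ ≤ σ := by
    rw [inv_le_comm₀ ht0 hσ, ← one_div]; exact ht
  rw [shift_line U hU C γ hC hγ1 hb t⁻¹ σ t hc hcσ ht0.le]
  refine (norm_integral_le_integral_norm _).trans ?_
  have h1 : ∫ y : ℝ, ‖Complex.exp (((t⁻¹ : ℝ) + y * Complex.I) * t) *
      U ((t⁻¹ : ℝ) + y * Complex.I)‖ ≤
      ∫ y : ℝ, Real.exp 1 * (C * ‖((t⁻¹ : ℝ) : ℂ) + y * Complex.I‖ ^ (γ - 2)) := by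
    apply integral_mono (integrable_expU U hU C γ hγ1 hb t⁻¹ t hc).norm
      (((integrable_vert γ t⁻¹ hγ1 hc).const_mul C).const_mul _)
    intro y
    simp only
    rw [norm_mul, norm_exp_vert, inv_mul_cancel₀ ht0.ne']
    gcongr
    exact hb _ (by simpa using ht0)
  refine h1.trans (le_of_eq ?_)
  rw [integral_const_mul, integral_const_mul, integral_vert γ t⁻¹ hc, Real.inv_rpow ht0.le,
    ← Real.rpow_neg ht0.le, neg_sub]
  ring

theorem hasSum_congr_term {f g : ℕ → ℂ} {a : ℂ} (h : ∀ j, f j = g j) :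
    HasSum f a ↔ HasSum g a := by rw [funext h]

theorem cos_le_of_mem (δ φ : ℝ) (hδ : 0 ≤ δ) (h1 : δ ≤ |φ|) (h2 : |φ| ≤ 2 * Real.pi - δ) :
    Real.cos φ ≤ Real.cos δ := by
  rw [← Real.cos_abs φ]
  rcases le_total |φ| Real.pi with h | h
  · exact Real.cos_le_cos_of_nonneg_of_le_pi hδ h h1
  · rw [← Real.cos_two_pi_sub |φ|]
    exact Real.cos_le_cos_of_nonneg_of_le_pi hδ (by linarith) (by linarith)

theorem sector_bound (α : ℝ) (hα0 : 0 < α) (lam : ℂ) (hlam : lam ≠ 0)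
    (harg : α * Real.pi / 2 < |Complex.arg lam|) :
    ∃ κ : ℝ, 0 < κ ∧ ∀ s : ℂ, 0 < s.re →
      κ * (1 + ‖lam * s ^ (-(α : ℂ))‖) ≤ ‖1 - lam * s ^ (-(α : ℂ))‖ := by
  set δ := |Complex.arg lam| - α * Real.pi / 2 with hδ
  have hpi := Real.pi_pos
  have hθ := Complex.abs_arg_le_pi lam
  have hδ0 : 0 < δ := by linarith
  have hδpi : δ ≤ Real.pi := by
    have : 0 < α * Real.pi := by positivity
    linarith
  have hcos : Real.cos δ < 1 := by
    rw [← Real.cos_zero]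
    exact Real.cos_lt_cos_of_nonneg_of_le_pi le_rfl hδpi hδ0
  set k := max (Real.cos δ) 0 with hk
  have hk0 : 0 ≤ k := le_max_right _ _
  have hk1 : k < 1 := max_lt hcos one_pos
  refine ⟨Real.sqrt ((1 - k) / 2), Real.sqrt_pos.2 (by linarith), fun s hs => ?_⟩
  have hs0 : s ≠ 0 := by rintro rfl; simp at hs
  have hq : lam * s ^ (-(α : ℂ)) = Complex.exp (Complex.log lam - α * Complex.log s) := by
    rw [Complex.cpow_def_of_ne_zero hs0, sub_eq_add_neg, Complex.exp_add, Complex.exp_log hlam]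
    congr 2
    ring
  have hre : (lam * s ^ (-(α : ℂ))).re =
      ‖lam * s ^ (-(α : ℂ))‖ * Real.cos (Complex.arg lam - α * Complex.arg s) := by
    rw [hq, Complex.exp_re, Complex.norm_exp]
    simp [Complex.log_im]
  set q := lam * s ^ (-(α : ℂ)) with hqd
  set φ := Complex.arg lam - α * Complex.arg s with hφ
  have hargs : |Complex.arg s| < Real.pi / 2 := Complex.abs_arg_lt_pi_div_two_iff.2 (Or.inl hs)
  have habs : |α * Complex.arg s| ≤ α * Real.pi / 2 := by
    rw [abs_mul, abs_of_pos hα0]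
    nlinarith
  have h1 : δ ≤ |φ| := by
    have := abs_sub_abs_le_abs_sub (Complex.arg lam) (α * Complex.arg s)
    linarith
  have h2 : |φ| ≤ 2 * Real.pi - δ := by
    have := abs_sub (Complex.arg lam) (α * Complex.arg s)
    linarith
  have hc : Real.cos φ ≤ k := (cos_le_of_mem δ φ hδ0.le h1 h2).trans (le_max_left _ _)
  have hx : 0 ≤ ‖q‖ := norm_nonneg q
  have hsq : ‖1 - q‖ ^ 2 = 1 + ‖q‖ ^ 2 - 2 * q.re := by
    rw [Complex.sq_norm, Complex.sq_norm, Complex.normSq_apply, Complex.normSq_apply]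
    simp
    ring
  have hfin : (Real.sqrt ((1 - k) / 2) * (1 + ‖q‖)) ^ 2 ≤ ‖1 - q‖ ^ 2 := by
    rw [mul_pow, Real.sq_sqrt (by linarith), hsq, hre]
    have : ‖q‖ * Real.cos φ ≤ ‖q‖ * k := by gcongr
    nlinarith [mul_nonneg hk0 (sq_nonneg (1 - ‖q‖)), sq_nonneg (1 - ‖q‖)]
  exact le_of_sq_le_sq hfin (norm_nonneg _)

theorem u_decay (α : ℝ) (hα0 : 0 < α) (hα1 : α ≤ 1) (lam : ℂ) (hlam : lam ≠ 0)
    (harg : α * Real.pi / 2 < |Complex.arg lam|) (c : ℕ → ℝ)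
    (hc : ∀ j, |c j| ≤ ((j : ℝ) + 1) ^ 2) (R : ℂ → ℂ)
    (hR : ∀ q : ℂ, ‖q‖ < 1 → HasSum (fun j : ℕ => (c j : ℂ) * q ^ j) (R q))
    (hRd : ∀ q : ℂ, q ≠ 1 → DifferentiableAt ℂ R q)
    (hRb : ∀ κ : ℝ, 0 < κ → ∃ C : ℝ, 0 ≤ C ∧ ∀ q : ℂ, κ * (1 + ‖q‖) ≤ ‖1 - q‖ →
      ‖R q‖ ≤ C / (1 + ‖q‖)) :
    Continuous (useries α lam c) ∧ ∃ D t₀ : ℝ, 0 < t₀ ∧ ∀ t, t₀ ≤ t →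
      ‖useries α lam c t‖ ≤ D * t ^ (1 - α / 2) := by
  obtain ⟨κ, hκ, hsec⟩ := sector_bound α hα0 lam hlam harg
  obtain ⟨C, hC, hCb⟩ := hRb κ hκ
  have hL : 0 < ‖lam‖ := norm_pos_iff.2 hlam
  set U : ℂ → ℂ := fun s => s ^ (-(2 : ℂ)) * R (lam * s ^ (-(α : ℂ))) with hU
  have hnq : ∀ s : ℂ, ‖lam * s ^ (-(α : ℂ))‖ = ‖lam‖ * ‖s‖ ^ (-α) := by
    intro s
    rw [norm_mul, show (-(α : ℂ)) = ((-α : ℝ) : ℂ) by push_cast; rfl, Complex.norm_cpow_real]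
  have hUd : DifferentiableOn ℂ U {z : ℂ | 0 < z.re} := by
    intro s hs
    have hs : 0 < s.re := hs
    have hsl : s ∈ Complex.slitPlane := Or.inl hs
    have hq1 : lam * s ^ (-(α : ℂ)) ≠ 1 := by
      intro h
      have := hsec s hs
      rw [h] at this
      simp at this
      linarith
    apply DifferentiableAt.differentiableWithinAt
    apply DifferentiableAt.mul
    · exact differentiableAt_id.cpow_const hsl
    · exact (hRd _ hq1).comp s ((differentiableAt_id.cpow_const hsl).const_mul lam)
  have hUb : ∀ s : ℂ, 0 < s.re → ‖U s‖ ≤ (C * ‖lam‖ ^ (-(1 / 2) : ℝ)) * ‖s‖ ^ (α / 2 - 2) := by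
    intro s hs
    have hs0 : s ≠ 0 := by rintro rfl; simp at hs
    have hns : 0 < ‖s‖ := norm_pos_iff.2 hs0
    have h1 := hCb _ (hsec s hs)
    rw [hnq] at h1
    set x := ‖lam‖ * ‖s‖ ^ (-α) with hx
    have hx0 : 0 < x := by positivity
    have h2 : C / (1 + x) ≤ C * x ^ (-(1 / 2) : ℝ) := by
      rw [div_eq_mul_inv]
      gcongr
      rw [Real.rpow_neg hx0.le]
      apply inv_anti₀ (by positivity)
      rw [← Real.sqrt_eq_rpow]
      nlinarith [Real.sq_sqrt hx0.le, sq_nonneg (Real.sqrt x - 1)]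
    have h3 : x ^ (-(1 / 2) : ℝ) = ‖lam‖ ^ (-(1 / 2) : ℝ) * ‖s‖ ^ (α / 2) := by
      rw [hx, Real.mul_rpow hL.le (by positivity), ← Real.rpow_mul hns.le]
      congr 2
      ring
    simp only [hU]
    rw [norm_mul, show (-(2 : ℂ)) = ((-2 : ℝ) : ℂ) by push_cast; rfl, Complex.norm_cpow_real]
    calc _ ≤ ‖s‖ ^ (-2 : ℝ) * (C * x ^ (-(1 / 2) : ℝ)) := by
          gcongr
          exact h1.trans h2
      _ = _ := by
          rw [h3, show α / 2 - 2 = -2 + α / 2 by ring, Real.rpow_add hns]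
          ring
  obtain ⟨σ, hσ, hσ1⟩ : ∃ σ : ℝ, 0 < σ ∧ ‖lam‖ * σ ^ (-α) < 1 := by
    have h1 := (tendsto_rpow_neg_atTop hα0).const_mul ‖lam‖
    rw [mul_zero] at h1
    obtain ⟨σ, h⟩ := ((eventually_gt_atTop 0).and (h1.eventually_lt_const one_pos)).exists
    exact ⟨σ, h⟩
  have hUs : ∀ s : ℂ, s.re = σ →
      HasSum (fun j : ℕ => (c j : ℂ) * lam ^ j * s ^ (-((α * j + 2 : ℝ) : ℂ))) (U s) := by
    intro s hs
    have hs0 : s ≠ 0 := by rintro rfl; simp at hs; linarith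
    have hle : σ ≤ ‖s‖ := by rw [← hs]; exact Complex.re_le_norm s
    have hq : ‖lam * s ^ (-(α : ℂ))‖ < 1 := by
      rw [hnq]
      refine lt_of_le_of_lt ?_ hσ1
      exact mul_le_mul_of_nonneg_left
        (Real.rpow_le_rpow_of_nonpos hσ hle (by linarith)) hL.le
    refine (hasSum_congr_term fun j => ?_).2 ((hR _ hq).mul_left (s ^ (-(2 : ℂ))))
    rw [mul_pow, ← Complex.cpow_nat_mul,
      show (-((α * j + 2 : ℝ) : ℂ)) = -(2 : ℂ) + j * (-(α : ℂ)) by push_cast; ring,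
      Complex.cpow_add _ _ hs0]
    ring
  have hγ : α / 2 < 1 := by linarith
  obtain ⟨hcont, hinv⟩ := u_inversion α hα0 lam c hc σ hσ hσ1 U hUs
    (integrable_U U hUd _ _ hγ hUb σ hσ)
  obtain ⟨D, hD⟩ := line_bound U hUd _ _ (by positivity) hγ hUb σ hσ
  refine ⟨hcont, 1 / (2 * Real.pi) * D, 1 / σ, by positivity, fun t ht => ?_⟩
  have hpi := Real.pi_pos
  rw [hinv, norm_mul, Complex.norm_real, Real.norm_of_nonneg (by positivity), mul_assoc]
  gcongr
  exact hD t ht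

theorem aux_div (κ x y : ℝ) (hκ : 0 < κ) (hx : 0 ≤ x) (h : κ * (1 + x) ≤ y) :
    1 / y ≤ κ⁻¹ / (1 + x) := by
  rw [inv_eq_one_div, div_div]
  exact one_div_le_one_div_of_le (by positivity) h

theorem u1_decay (α : ℝ) (hα0 : 0 < α) (hα1 : α ≤ 1) (lam : ℂ) (hlam : lam ≠ 0)
    (harg : α * Real.pi / 2 < |Complex.arg lam|) :
    Continuous (useries α lam fun j => α * j + 1) ∧ ∃ D t₀ : ℝ, 0 < t₀ ∧ ∀ t, t₀ ≤ t →
      ‖useries α lam (fun j => α * j + 1) t‖ ≤ D * t ^ (1 - α / 2) := by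
  refine u_decay α hα0 hα1 lam hlam harg _ ?_
    (fun q => α * (q / (1 - q) ^ 2) + (1 - q)⁻¹) ?_ ?_ ?_
  · intro j
    rw [abs_of_nonneg (by positivity)]
    have : (0 : ℝ) ≤ j := by positivity
    nlinarith
  · intro q hq
    refine (hasSum_congr_term fun j => ?_).2 (((hasSum_coe_mul_geometric_of_norm_lt_one hq).mul_left
      (α : ℂ)).add (hasSum_geometric_of_norm_lt_one hq))
    push_cast; ring
  · intro q hq
    have : (1 - q) ≠ 0 := sub_ne_zero.2 hq.symm
    have h2 : (1 - q) ^ 2 ≠ 0 := pow_ne_zero _ this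
    fun_prop (disch := assumption)
  · intro κ hκ
    refine ⟨α * κ⁻¹ ^ 2 + κ⁻¹, by positivity, fun q hq => ?_⟩
    have h := aux_div κ ‖q‖ _ hκ (norm_nonneg _) hq
    have hx := norm_nonneg q
    calc _ ≤ ‖(α : ℂ) * (q / (1 - q) ^ 2)‖ + ‖(1 - q)⁻¹‖ := norm_add_le _ _
      _ = α * (‖q‖ * (1 / ‖1 - q‖) ^ 2) + 1 / ‖1 - q‖ := by
          rw [norm_mul, norm_div, norm_pow, norm_inv, Complex.norm_real,
            Real.norm_of_nonneg hα0.le, one_div, inv_pow, div_eq_mul_inv]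
      _ ≤ α * ((1 + ‖q‖) * (κ⁻¹ / (1 + ‖q‖)) ^ 2) + κ⁻¹ / (1 + ‖q‖) := by
          gcongr
          linarith
      _ = _ := by field_simp

theorem u2_decay (α : ℝ) (hα0 : 0 < α) (hα1 : α ≤ 1) (lam : ℂ) (hlam : lam ≠ 0)
    (harg : α * Real.pi / 2 < |Complex.arg lam|) :
    Continuous (useries α lam fun j => α * j * (α * j + 1)) ∧ ∃ D t₀ : ℝ, 0 < t₀ ∧ ∀ t, t₀ ≤ t →
      ‖useries α lam (fun j => α * j * (α * j + 1)) t‖ ≤ D * t ^ (1 - α / 2) := by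
  refine u_decay α hα0 hα1 lam hlam harg _ ?_
    (fun q => α ^ 2 * (q * (1 + q) / (1 - q) ^ 3) + α * (q / (1 - q) ^ 2)) ?_ ?_ ?_
  · intro j
    rw [abs_of_nonneg (by positivity), sq]
    have : (0 : ℝ) ≤ j := by positivity
    gcongr <;> nlinarith
  · intro q hq
    have hne : (1 - q) ≠ 0 := by
      intro h
      have : q = 1 := (sub_eq_zero.1 h).symm
      rw [this] at hq; simp at hq
    have h1 := hasSum_coe_mul_geometric_of_norm_lt_one hq
    have h0 := hasSum_geometric_of_norm_lt_one hq
    have h2 := hasSum_choose_mul_geometric_of_norm_lt_one 2 hq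
    have h3 := ((((h2.mul_left 2).sub (h1.mul_left 3)).sub (h0.mul_left 2)).mul_left
      ((α : ℂ) ^ 2)).add (h1.mul_left (α : ℂ))
    have e : (α : ℂ) ^ 2 * (q * (1 + q) / (1 - q) ^ 3) + α * (q / (1 - q) ^ 2) =
        (α : ℂ) ^ 2 * (2 * (1 / (1 - q) ^ (2 + 1)) - 3 * (q / (1 - q) ^ 2) - 2 * (1 - q)⁻¹) +
        α * (q / (1 - q) ^ 2) := by
      congr 1
      field_simp
      ring
    simp only [e]
    refine (hasSum_congr_term fun j => ?_).2 h3
    · have : (((j + 2).choose 2 : ℕ) : ℂ) = ((j : ℂ) + 2) * (j + 1) / 2 := by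
        rw [Nat.cast_choose_two]; push_cast; ring
      rw [this]
      push_cast; ring
  · intro q hq
    have : (1 - q) ≠ 0 := sub_ne_zero.2 hq.symm
    have h2 : (1 - q) ^ 2 ≠ 0 := pow_ne_zero _ this
    have h3 : (1 - q) ^ 3 ≠ 0 := pow_ne_zero _ this
    fun_prop (disch := assumption)
  · intro κ hκ
    refine ⟨α ^ 2 * κ⁻¹ ^ 3 + α * κ⁻¹ ^ 2, by positivity, fun q hq => ?_⟩
    have h := aux_div κ ‖q‖ _ hκ (norm_nonneg _) hq
    have hx := norm_nonneg q
    have h1q : ‖1 + q‖ ≤ 1 + ‖q‖ := by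
      simpa using norm_add_le 1 q
    calc _ ≤ ‖(α : ℂ) ^ 2 * (q * (1 + q) / (1 - q) ^ 3)‖ + ‖(α : ℂ) * (q / (1 - q) ^ 2)‖ :=
          norm_add_le _ _
      _ = α ^ 2 * (‖q‖ * ‖1 + q‖ * (1 / ‖1 - q‖) ^ 3) + α * (‖q‖ * (1 / ‖1 - q‖) ^ 2) := by
          simp only [norm_mul, norm_pow, Complex.norm_real,
            Real.norm_of_nonneg hα0.le, div_eq_mul_inv, norm_inv, one_mul, inv_pow]
      _ ≤ α ^ 2 * ((1 + ‖q‖) * (1 + ‖q‖) * (κ⁻¹ / (1 + ‖q‖)) ^ 3) +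
          α * ((1 + ‖q‖) * (κ⁻¹ / (1 + ‖q‖)) ^ 2) := by
          gcongr <;> linarith
      _ = _ := by field_simp

theorem useries_one (α : ℝ) (hα0 : 0 < α) (lam : ℂ) (t : ℝ) (ht : 0 < t) :
    useries α lam (fun j => α * j + 1) t = t * ML α 1 (lam * ((t ^ α : ℝ) : ℂ)) := by
  rw [useries, ML, ← tsum_mul_left]
  refine tsum_congr fun j => ?_
  have h1 : 0 < α * j + 1 := by positivity
  have hG : ((Real.Gamma (α * j + 1) : ℝ) : ℂ) ≠ 0 := by
    exact_mod_cast (Real.Gamma_pos_of_pos h1).ne'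
  have h1' : ((α * j + 1 : ℝ) : ℂ) ≠ 0 := by exact_mod_cast h1.ne'
  rw [max_eq_left ht.le, show α * (j : ℝ) + 2 = α * j + 1 + 1 by ring,
    Real.Gamma_add_one h1.ne', Real.rpow_add ht, Real.rpow_mul ht.le, Real.rpow_natCast,
    Real.rpow_one, mul_pow, Complex.ofReal_div, Complex.ofReal_mul, Complex.ofReal_mul,
    Complex.ofReal_pow]
  field_simp

theorem useries_two (α : ℝ) (hα0 : 0 < α) (lam : ℂ) (t : ℝ) (ht : 0 < t) :
    useries α lam (fun j => α * j * (α * j + 1)) t =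
      lam * t ^ 2 * (((t ^ (α - 1) : ℝ) : ℂ) * ML α α (lam * ((t ^ α : ℝ) : ℂ))) := by
  rw [useries, ML, ← tsum_mul_left, ← tsum_mul_left]
  rw [← (add_left_injective 1 : Function.Injective fun j : ℕ => j + 1).tsum_eq]
  · refine tsum_congr fun j => ?_
    have h0 : 0 < α * j + α := by positivity
    have h1 : 0 < α * j + α + 1 := by positivity
    have hG : ((Real.Gamma (α * j + α) : ℝ) : ℂ) ≠ 0 := by
      exact_mod_cast (Real.Gamma_pos_of_pos h0).ne'
    have h0' : ((α * j + α : ℝ) : ℂ) ≠ 0 := by exact_mod_cast h0.ne'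
    have h1' : ((α * j + α + 1 : ℝ) : ℂ) ≠ 0 := by exact_mod_cast h1.ne'
    have ht' : (t : ℂ) ≠ 0 := by exact_mod_cast ht.ne'
    rw [max_eq_left ht.le, Nat.cast_add, Nat.cast_one, show α * ((j : ℝ) + 1) = α * j + α by ring,
      show α * (j : ℝ) + α + 2 = α * j + α + 1 + 1 by ring,
      Real.Gamma_add_one h1.ne', Real.Gamma_add_one h0.ne', Real.rpow_add ht, Real.rpow_add ht,
      Real.rpow_mul ht.le, Real.rpow_natCast,
      Real.rpow_one, Real.rpow_sub ht, Real.rpow_one, mul_pow, Complex.ofReal_div,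
      Complex.ofReal_mul, Complex.ofReal_mul, Complex.ofReal_mul, Complex.ofReal_mul,
      Complex.ofReal_mul, Complex.ofReal_div, Complex.ofReal_pow]
    generalize ((Real.Gamma (α * j + α) : ℝ) : ℂ) = G at hG ⊢
    generalize ((α * j + α + 1 : ℝ) : ℂ) = B at h1' ⊢
    generalize ((α * j + α : ℝ) : ℂ) = A at h0' ⊢
    field_simp
    try ring
  · intro j hj
    rcases j with _ | j
    · simp at hj
    · exact ⟨j, rfl⟩

theorem summable_ML (α : ℝ) (hα0 : 0 < α) (hα1 : α ≤ 1) (x : ℝ) (hx : 0 ≤ x) :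
    Summable fun j : ℕ => x ^ j / Real.Gamma (α * j + α) := by
  obtain ⟨y, hy, hy1⟩ : ∃ y : ℝ, 0 < y ∧ x * y ^ (-α) < 1 := by
    have h1 := (tendsto_rpow_neg_atTop hα0).const_mul x
    rw [mul_zero] at h1
    obtain ⟨σ, h⟩ := ((eventually_gt_atTop 0).and (h1.eventually_lt_const one_pos)).exists
    exact ⟨σ, h⟩
  have hs := summable_c (fun j => (j : ℝ) + 1) (by
    intro j
    have : (0 : ℝ) ≤ j := by positivity
    rw [abs_of_nonneg (by positivity)]
    nlinarith) (x * y ^ (-α)) (by positivity) hy1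
  refine Summable.of_nonneg_of_le (fun j => ?_) (fun j => ?_)
    ((hs.mul_right (y ^ (-α))).mul_right (Real.exp y))
  · have := Real.Gamma_pos_of_pos (show 0 < α * j + α by positivity)
    positivity
  · have h0 : 0 < α * j + α := by positivity
    have hG := Real.Gamma_pos_of_pos h0
    have h1 := gamma_lb (α * j + α) y h0.le hy
    rw [Real.Gamma_add_one h0.ne'] at h1
    rw [mul_assoc |_|, ← rpow_lin α y x hy j α, abs_of_nonneg (by positivity),
      Real.rpow_neg hy.le, div_le_iff₀ hG]
    have h2 : α * j + α ≤ j + 1 := by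
      have : (0 : ℝ) ≤ j := by positivity
      nlinarith
    have h3 : y ^ (α * j + α) * Real.exp (-y) ≤ (j + 1) * Real.Gamma (α * j + α) :=
      h1.trans (by gcongr)
    have h4 : 1 ≤ (j + 1) * Real.Gamma (α * j + α) * ((y ^ (α * j + α))⁻¹ * Real.exp y) := by
      calc (1 : ℝ) = y ^ (α * j + α) * Real.exp (-y) * ((y ^ (α * j + α))⁻¹ * Real.exp y) := by
            rw [Real.exp_neg]
            have : 0 < y ^ (α * j + α) := by positivity
            field_simp
        _ ≤ _ := by gcongr
    calc x ^ j = x ^ j * 1 := by ring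
      _ ≤ x ^ j * ((j + 1) * Real.Gamma (α * j + α) * ((y ^ (α * j + α))⁻¹ * Real.exp y)) := by
          gcongr
      _ = _ := by ring

theorem ML_bound (α : ℝ) (hα0 : 0 < α) (hα1 : α ≤ 1) (x : ℝ) (hx : 0 ≤ x) (z : ℂ)
    (hz : ‖z‖ ≤ x) : ‖ML α α z‖ ≤ ∑' j : ℕ, x ^ j / Real.Gamma (α * j + α) := by
  refine tsum_of_norm_bounded (summable_ML α hα0 hα1 x hx).hasSum fun j => ?_
  have := Real.Gamma_pos_of_pos (show 0 < α * j + α by positivity)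
  rw [norm_div, norm_pow, Complex.norm_real, Real.norm_of_nonneg this.le]
  gcongr

/-- The kernel. -/
noncomputable def mlKer (α : ℝ) (lam : ℂ) (t : ℝ) : ℂ :=
  ((t ^ (α - 1) : ℝ) : ℂ) * ML α α (lam * ((t ^ α : ℝ) : ℂ))

theorem ker_integrable (α : ℝ) (hα0 : 0 < α) (hα1 : α ≤ 1) (lam : ℂ) (hlam : lam ≠ 0)
    (harg : α * Real.pi / 2 < |Complex.arg lam|) :
    ContinuousOn (mlKer α lam) (Set.Ioi 0) ∧ IntegrableOn (mlKer α lam) (Set.Ioi 0) := by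
  obtain ⟨hcont, D, t₀, ht₀, hD⟩ := u2_decay α hα0 hα1 lam hlam harg
  have hL : 0 < ‖lam‖ := norm_pos_iff.2 hlam
  have hker : ∀ t ∈ Set.Ioi (0 : ℝ), mlKer α lam t =
      useries α lam (fun j => α * j * (α * j + 1)) t / (lam * t ^ 2) := by
    intro t ht
    have ht : 0 < t := ht
    have ht' : (t : ℂ) ≠ 0 := by exact_mod_cast ht.ne'
    rw [useries_two α hα0 lam t ht, mlKer]
    field_simp
  have hc : ContinuousOn (mlKer α lam) (Set.Ioi 0) := by
    refine ContinuousOn.congr ?_ hker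
    refine hcont.continuousOn.div (by fun_prop) ?_
    intro t ht
    have ht : 0 < t := ht
    have ht' : (t : ℂ) ≠ 0 := by exact_mod_cast ht.ne'
    positivity
  refine ⟨hc, ?_⟩
  rw [← Set.Ioc_union_Ioi_eq_Ioi ht₀.le]
  refine IntegrableOn.union ?_ ?_
  · have h1 : IntegrableOn (fun t : ℝ => t ^ (α - 1)) (Set.Ioc 0 t₀) :=
      (intervalIntegrable_iff_integrableOn_Ioc_of_le ht₀.le).1
        (intervalIntegral.intervalIntegrable_rpow' (by linarith))
    refine (h1.mul_const (∑' j : ℕ, (‖lam‖ * t₀ ^ α) ^ j / Real.Gamma (α * j + α))).mono'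
      ((hc.mono fun t ht => ht.1).aestronglyMeasurable measurableSet_Ioc) ?_
    filter_upwards [self_mem_ae_restrict measurableSet_Ioc] with t ht
    have ht0 : 0 < t := ht.1
    rw [mlKer, norm_mul, Complex.norm_real, Real.norm_of_nonneg (by positivity)]
    gcongr
    apply ML_bound α hα0 hα1 _ (by positivity)
    rw [norm_mul, Complex.norm_real, Real.norm_of_nonneg (by positivity)]
    have := ht.2
    gcongr
  · have h1 : IntegrableOn (fun t : ℝ => t ^ (-1 - α / 2)) (Set.Ioi t₀) :=
      integrableOn_Ioi_rpow_of_lt (by linarith) ht₀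
    refine (h1.const_mul (D / ‖lam‖)).mono'
      ((hc.mono (Set.Ioi_subset_Ioi ht₀.le)).aestronglyMeasurable measurableSet_Ioi) ?_
    filter_upwards [self_mem_ae_restrict measurableSet_Ioi] with t ht
    have htt : t₀ < t := ht
    have ht0 : 0 < t := ht₀.trans htt
    rw [hker t ht0, norm_div, norm_mul, norm_pow, Complex.norm_real, Real.norm_of_nonneg ht0.le,
      div_le_iff₀ (by positivity)]
    refine (hD t htt.le).trans (le_of_eq ?_)
    rw [show 1 - α / 2 = -1 - α / 2 + 2 by ring, Real.rpow_add ht0, Real.rpow_two]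
    field_simp

theorem conv_tendsto (K f : ℝ → ℂ) (hKc : ContinuousOn K (Set.Ioi 0))
    (hK : IntegrableOn K (Set.Ioi 0)) (hf : ContinuousOn f (Set.Ici 0))
    (hf0 : Tendsto f atTop (nhds 0)) :
    Tendsto (fun t : ℝ => ∫ τ in (0 : ℝ)..t, K (t - τ) * f τ) atTop (nhds 0) := by
  obtain ⟨M, hM0, hM⟩ : ∃ M : ℝ, 0 ≤ M ∧ ∀ x, 0 ≤ x → ‖f x‖ ≤ M := by
    have h1 : ∀ᶠ x in atTop, ‖f x‖ < 1 := by
      have := hf0.norm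
      rw [norm_zero] at this
      exact this.eventually_lt_const one_pos
    obtain ⟨N, hN⟩ := eventually_atTop.1 h1
    obtain ⟨B, hB⟩ := (isCompact_Icc (a := (0 : ℝ)) (b := N)).exists_bound_of_continuousOn
      (hf.mono fun x hx => hx.1)
    refine ⟨max B 1, le_trans zero_le_one (le_max_right _ _), fun x hx => ?_⟩
    rcases le_total x N with h | h
    · exact (hB x ⟨hx, h⟩).trans (le_max_left _ _)
    · exact (hN x h).le.trans (le_max_right _ _)
  have hrew : ∀ᶠ t : ℝ in atTop, ∫ τ : ℝ, (Set.Ioc 0 t).indicator (fun τ => K τ * f (t - τ)) τ =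
      ∫ τ in (0 : ℝ)..t, K (t - τ) * f τ := by
    filter_upwards [eventually_ge_atTop 0] with t ht
    have := intervalIntegral.integral_comp_sub_left (a := 0) (b := t)
      (fun x => K x * f (t - x)) t
    simp only [sub_sub_cancel, sub_self, sub_zero] at this
    rw [this, intervalIntegral.integral_of_le ht, integral_indicator measurableSet_Ioc]
  refine Tendsto.congr' hrew ?_
  rw [← integral_zero ℝ ℂ (μ := volume)]
  refine tendsto_integral_filter_of_dominated_convergence
    ((Set.Ioi (0 : ℝ)).indicator fun τ => ‖K τ‖ * M) ?_ ?_ ?_ ?_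
  · refine Eventually.of_forall fun t => ?_
    rw [aestronglyMeasurable_indicator_iff measurableSet_Ioc]
    refine ContinuousOn.aestronglyMeasurable ?_ measurableSet_Ioc
    refine (hKc.mono fun τ hτ => hτ.1).mul (hf.comp (by fun_prop) ?_)
    intro τ hτ
    exact sub_nonneg.2 hτ.2
  · refine Eventually.of_forall fun t => Eventually.of_forall fun τ => ?_
    by_cases h : τ ∈ Set.Ioc 0 t
    · rw [Set.indicator_of_mem h, Set.indicator_of_mem (show τ ∈ Set.Ioi 0 from h.1), norm_mul]
      gcongr
      exact hM _ (sub_nonneg.2 h.2)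
    · rw [Set.indicator_of_notMem h, norm_zero]
      exact Set.indicator_nonneg (fun x _ => by positivity) _
  · rw [integrable_indicator_iff measurableSet_Ioi]
    exact hK.norm.mul_const M
  · refine Eventually.of_forall fun τ => ?_
    have h1 : Tendsto (fun t : ℝ => ‖K τ‖ * ‖f (t - τ)‖) atTop (nhds 0) := by
      have := (hf0.comp (tendsto_atTop_add_const_right atTop (-τ) tendsto_id)).norm.const_mul ‖K τ‖
      simpa [Function.comp_def, ← sub_eq_add_neg] using this
    refine squeeze_zero_norm (fun t => ?_) h1
    refine (norm_indicator_le_norm_self _ _).trans ?_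
    rw [norm_mul]

theorem stmt_14
    (α : ℝ) (hα : α ∈ Set.Ioc (0 : ℝ) 1)
    (lam : ℂ) (hlam : lam ≠ 0) (harg : α * Real.pi / 2 < |Complex.arg lam|)
    (f : ℝ → ℂ) (hf : ContinuousOn f (Set.Ici 0))
    (hf0 : Tendsto f atTop (nhds 0))
    (x₀ : ℂ) :
    Tendsto
      (fun t : ℝ => x₀ * ML α 1 (lam * ((t ^ α : ℝ) : ℂ)) +
        ∫ τ in (0 : ℝ)..t,
          (((t - τ) ^ (α - 1) : ℝ) : ℂ) * ML α α (lam * (((t - τ) ^ α : ℝ) : ℂ)) * f τ)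
      atTop (nhds 0) := by
  obtain ⟨hα0, hα1⟩ := hα
  obtain ⟨hKc, hK⟩ := ker_integrable α hα0 hα1 lam hlam harg
  have h2 := conv_tendsto (mlKer α lam) f hKc hK hf hf0
  have h1 : Tendsto (fun t : ℝ => ML α 1 (lam * ((t ^ α : ℝ) : ℂ))) atTop (nhds 0) := by
    obtain ⟨-, D, t₀, ht₀, hD⟩ := u1_decay α hα0 hα1 lam hlam harg
    have hlim : Tendsto (fun t : ℝ => D * t ^ (-(α / 2))) atTop (nhds 0) := by
      simpa using (tendsto_rpow_neg_atTop (show 0 < α / 2 by linarith)).const_mul D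
    refine squeeze_zero_norm' ?_ hlim
    filter_upwards [eventually_ge_atTop t₀] with t ht
    have ht0 : 0 < t := ht₀.trans_le ht
    have := hD t ht
    rw [useries_one α hα0 lam t ht0, norm_mul, Complex.norm_real, Real.norm_of_nonneg ht0.le,
      sub_eq_add_neg, Real.rpow_add ht0, Real.rpow_one] at this
    refine le_of_mul_le_mul_left (this.trans (le_of_eq ?_)) ht0
    ring
  have h3 := (h1.const_mul x₀).add h2
  rw [mul_zero, add_zero] at h3
  exact h3
end

section
/- Let α₁, α₂ ∈ (0,1] and a₁₁, a₂₂ ∈ ℂ \ {0}, a₁₂ ∈ ℂ with |arg a₁₁| > α₁π/2 and |arg a₂₂| > α₂π/2. Then for all x₁⁰, x₂⁰ ∈ ℂ, the functions x₂(t) = x₂⁰ E_{α₂}(a₂₂ t^{α₂}) and x₁(t) = x₁⁰ E_{α₁}(a₁₁ t^{α₁}) + a₁₂ ∫₀ᵗ (t−s)^{α₁−1} E_{α₁,α₁}(a₁₁(t−s)^{α₁}) x₂(s) ds both tend to 0 as t → ∞. -/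
open Filter MeasureTheory

theorem gamma_lower (x R : ℝ) (hx : 1 ≤ x) (hR : 0 < R) :
    R ^ (x - 1) * Real.exp (-R) ≤ Real.Gamma x := by
  rw [Real.Gamma_eq_integral (by linarith)]
  have hi := Real.GammaIntegral_convergent (s := x) (by linarith)
  have h1 : ∫ u in Set.Ioi R, R ^ (x - 1) * Real.exp (-u) = R ^ (x - 1) * Real.exp (-R) := by
    rw [integral_const_mul, integral_exp_neg_Ioi]
  rw [← h1]
  calc _ ≤ ∫ u in Set.Ioi R, Real.exp (-u) * u ^ (x - 1) := by
        refine setIntegral_mono_on ((integrableOn_exp_neg_Ioi R).const_mul _)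
          (hi.mono_set (Set.Ioi_subset_Ioi hR.le)) measurableSet_Ioi fun u hu => ?_
        rw [mul_comm]
        have : R < u := hu
        gcongr
    _ ≤ _ := by
        refine setIntegral_mono_set hi ?_ (Set.Ioi_subset_Ioi hR.le).eventuallyLE
        filter_upwards [ae_restrict_mem measurableSet_Ioi] with u hu
        have : 0 < u := hu
        simp only [Pi.zero_apply]
        positivity

theorem ml_summable (α β : ℝ) (hα : 0 < α) (hβ : 0 < β) (r : ℝ) (hr : 0 ≤ r) :
    Summable (fun j : ℕ => r ^ j / Real.Gamma (α * j + β)) := by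
  obtain ⟨R, hR, hq⟩ : ∃ R : ℝ, 0 < R ∧ r / R ^ α < 1 := by
    have h1 := tendsto_rpow_atTop hα
    obtain ⟨R, hR1, hR2⟩ := ((h1.eventually_gt_atTop r).and (eventually_gt_atTop 0)).exists
    exact ⟨R, hR2, by rw [div_lt_one (by positivity)]; exact hR1⟩
  have hs := (summable_geometric_of_lt_one (by positivity) hq).mul_left (R ^ (1 - β) * Real.exp R)
  refine Summable.of_norm_bounded_eventually_nat hs ?_
  have h2 : Tendsto (fun j : ℕ => α * (j:ℝ) + β) atTop atTop :=
    tendsto_atTop_add_const_right _ _ (tendsto_natCast_atTop_atTop.const_mul_atTop hα)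
  filter_upwards [h2.eventually_ge_atTop 1] with j hj
  have hg := gamma_lower _ R hj hR
  have hgp : 0 < Real.Gamma (α * j + β) := Real.Gamma_pos_of_pos (by positivity)
  rw [Real.norm_of_nonneg (by positivity), div_le_iff₀ hgp]
  refine le_trans (le_of_eq ?_) (mul_le_mul_of_nonneg_left hg (by positivity))
  have e1 : R ^ (α * j + β - 1) = (R ^ α) ^ j * R ^ (β - 1) := by
    rw [← Real.rpow_mul_natCast hR.le, ← Real.rpow_add hR]; congr 1; ring
  have e2 : R ^ (1 - β) * R ^ (β - 1) = 1 := by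
    rw [← Real.rpow_add hR]; simp
  have e3 : Real.exp R * Real.exp (-R) = 1 := by rw [← Real.exp_add]; simp
  rw [e1, div_pow]
  have : (R ^ α) ^ j ≠ 0 := by positivity
  field_simp
  linear_combination (- r ^ j) * e2 * 1 - r^j * e3 * (R ^ (1 - β) * R ^ (β - 1))

theorem ml_term_norm (α β : ℝ) (hα : 0 < α) (hβ : 0 < β) (z : ℂ) (j : ℕ) :
    ‖z ^ j / ((Real.Gamma (α * j + β) : ℝ) : ℂ)‖ = ‖z‖ ^ j / Real.Gamma (α * j + β) := by
  rw [norm_div, norm_pow, Complex.norm_real, Real.norm_of_nonneg]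
  exact (Real.Gamma_pos_of_pos (by positivity)).le

theorem ml_continuous (α β : ℝ) (hα : 0 < α) (hβ : 0 < β) : Continuous (ML α β) := by
  rw [continuous_iff_continuousAt]
  intro z
  have : ContinuousOn (ML α β) (Metric.ball 0 (‖z‖ + 1)) := by
    refine continuousOn_tsum (fun j => by fun_prop) (ml_summable α β hα hβ (‖z‖ + 1) (by positivity)) ?_
    intro j w hw
    rw [ml_term_norm α β hα hβ]
    have : ‖w‖ < ‖z‖ + 1 := by simpa using hw
    have hgp : 0 < Real.Gamma (α * j + β) := Real.Gamma_pos_of_pos (by positivity)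
    gcongr
  exact this.continuousAt (Metric.isOpen_ball.mem_nhds (by simp))

theorem sector_gap (α : ℝ) (hα : 0 < α) (hα1 : α ≤ 1) (a : ℂ) (ha : a ≠ 0)
    (harg : α * Real.pi / 2 < |Complex.arg a|) :
    ∃ δ > 0, ∀ s : ℂ, 0 < s.re → δ ≤ ‖s ^ (α : ℂ) - a‖ := by
  have hpi := Real.pi_pos
  set S : Set ℂ := {z | Real.cos (α * Real.pi / 2) * ‖z‖ ≤ z.re}
  have hS : IsClosed S := isClosed_le (by fun_prop) Complex.continuous_re
  have haS : a ∉ S := by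
    intro h
    have h : Real.cos (α * Real.pi / 2) * ‖a‖ ≤ a.re := h
    rw [← Complex.norm_mul_cos_arg a, ← Real.cos_abs a.arg, mul_comm] at h
    have := le_of_mul_le_mul_left h (norm_pos_iff.2 ha)
    have h2 := Real.cos_lt_cos_of_nonneg_of_le_pi (by positivity) (Complex.abs_arg_le_pi a) harg
    linarith
  obtain ⟨δ, hδ, hb⟩ := Metric.isOpen_iff.1 hS.isOpen_compl a haS
  refine ⟨δ, hδ, fun s hs => ?_⟩
  by_contra hlt
  push Not at hlt
  have hmem := hb (show s ^ (α:ℂ) ∈ Metric.ball a δ by rwa [Metric.mem_ball, dist_eq_norm])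
  apply hmem
  show Real.cos (α * Real.pi / 2) * ‖s ^ (α:ℂ)‖ ≤ (s ^ (α:ℂ)).re
  have hs0 : s ≠ 0 := by rintro rfl; simp at hs
  have hsa : |s.arg| < Real.pi / 2 := by
    rw [Complex.abs_arg_lt_pi_div_two_iff]; exact Or.inl hs
  rw [Complex.cpow_ofReal_re, Complex.norm_cpow_real, mul_comm]
  refine mul_le_mul_of_nonneg_left ?_ (by positivity)
  rw [← Real.cos_abs (s.arg * α), abs_mul, abs_of_pos hα]
  refine Real.cos_le_cos_of_nonneg_of_le_pi (by positivity) (by nlinarith) ?_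
  nlinarith

theorem laplace_integrable (b : ℝ) (hb : 0 < b) (s : ℂ) (hs : 0 < s.re) :
    IntegrableOn (fun t : ℝ => ((t ^ (b - 1) : ℝ) : ℂ) * Complex.exp (-(s * t))) (Set.Ioi 0) := by
  have h := integrableOn_rpow_mul_exp_neg_mul_rpow (p := 1) (s := b - 1) (b := s.re)
    (by linarith) one_pos hs
  refine Integrable.mono' h ?_ ?_
  · refine ContinuousOn.aestronglyMeasurable ?_ measurableSet_Ioi
    refine ContinuousOn.mul ?_ (by fun_prop)
    refine Complex.continuous_ofReal.comp_continuousOn ?_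
    exact fun t ht => (Real.continuousAt_rpow_const _ _ (Or.inl (ne_of_gt ht))).continuousWithinAt
  · filter_upwards [ae_restrict_mem measurableSet_Ioi] with t ht
    have ht' : 0 < t := ht
    rw [norm_mul, Complex.norm_exp, Complex.norm_real, Real.norm_eq_abs,
      abs_of_nonneg (Real.rpow_nonneg ht'.le _)]
    simp

theorem laplace_pow (b : ℝ) (hb : 0 < b) (s : ℂ) (hs : 0 < s.re) :
    ∫ t : ℝ in Set.Ioi 0, ((t ^ (b - 1) : ℝ) : ℂ) * Complex.exp (-(s * t))
      = (Real.Gamma b : ℂ) * s ^ (-(b : ℂ)) := by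
  set U : Set ℂ := {s | 0 < s.re} with hU
  have hUo : IsOpen U := isOpen_lt continuous_const Complex.continuous_re
  have hUc : IsPreconnected U := (convex_halfSpace_re_gt 0).isPreconnected
  set L : ℂ → ℂ := fun s => ∫ t : ℝ in Set.Ioi 0, ((t ^ (b - 1) : ℝ) : ℂ) * Complex.exp (-(s * t))
  have hL : DifferentiableOn ℂ L U := by
    intro z hz
    have hz : 0 < z.re := hz
    refine DifferentiableAt.differentiableWithinAt ?_
    have hb2 := integrableOn_rpow_mul_exp_neg_mul_rpow (p := 1) (s := b) (b := z.re / 2)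
      (by linarith) one_pos (by linarith)
    have key := hasDerivAt_integral_of_dominated_loc_of_deriv_le (μ := volume.restrict (Set.Ioi (0:ℝ)))
      (F := fun (s : ℂ) (t : ℝ) => ((t ^ (b - 1) : ℝ) : ℂ) * Complex.exp (-(s * t)))
      (F' := fun (s : ℂ) (t : ℝ) => ((t ^ (b - 1) : ℝ) : ℂ) * (Complex.exp (-(s * t)) * (-t)))
      (x₀ := z) (s := Metric.ball z (z.re / 2))
      (bound := fun t => t ^ b * Real.exp (-(z.re/2) * t ^ (1:ℝ))) (Metric.ball_mem_nhds z (by linarith)) ?_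
      (laplace_integrable b hb z hz) ?_ ?_ hb2 ?_
    · exact key.2.differentiableAt
    · filter_upwards [hUo.mem_nhds hz] with s hs
      exact (laplace_integrable b hb s hs).1
    · refine ContinuousOn.aestronglyMeasurable ?_ measurableSet_Ioi
      refine ContinuousOn.mul ?_ (by fun_prop)
      refine Complex.continuous_ofReal.comp_continuousOn ?_
      exact fun t ht => (Real.continuousAt_rpow_const _ _ (Or.inl (ne_of_gt ht))).continuousWithinAt
    · filter_upwards [ae_restrict_mem measurableSet_Ioi] with t ht s hs
      have ht' : 0 < t := ht
      have h1 : z.re / 2 ≤ s.re := by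
        have h2 : |(s - z).re| < z.re / 2 :=
          (Complex.abs_re_le_norm _).trans_lt (by simpa [dist_eq_norm] using hs)
        rw [abs_lt, Complex.sub_re] at h2
        linarith
      rw [norm_mul, norm_mul, Complex.norm_exp, norm_neg, Complex.norm_real, Complex.norm_real,
        Real.norm_eq_abs, Real.norm_eq_abs, abs_of_nonneg (Real.rpow_nonneg ht'.le _),
        abs_of_pos ht', mul_comm (Real.exp _), ← mul_assoc]
      have h3 : t ^ (b - 1) * t = t ^ b := by
        rw [← Real.rpow_add_one ht'.ne']; simp
      rw [h3]
      gcongr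
      simp
      nlinarith
    · refine Eventually.of_forall fun t s _ => ?_
      have h4 : HasDerivAt (fun s : ℂ => -(s * t)) (-(t:ℂ)) s := by
        have := ((hasDerivAt_id s).mul_const (t:ℂ)).neg
        rw [one_mul] at this
        exact this
      exact (h4.cexp).const_mul _
  have hR : DifferentiableOn ℂ (fun s : ℂ => (Real.Gamma b : ℂ) * s ^ (-(b : ℂ))) U := by
    intro z hz
    refine DifferentiableAt.differentiableWithinAt ?_
    refine DifferentiableAt.const_mul ?_ _
    exact DifferentiableAt.cpow_const differentiableAt_id (Or.inl hz)
  have hEq : Set.EqOn L (fun s : ℂ => (Real.Gamma b : ℂ) * s ^ (-(b : ℂ))) U := by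
    refine (hL.analyticOnNhd hUo).eqOn_of_preconnected_of_frequently_eq (hR.analyticOnNhd hUo) hUc
      (z₀ := 1) (by simp [hU]) ?_
    have hreal : ∀ r : ℝ, 0 < r → L r = (Real.Gamma b : ℂ) * (r : ℂ) ^ (-(b : ℂ)) := by
      intro r hr
      have h5 := congrArg (fun x : ℝ => (x : ℂ)) (Real.integral_rpow_mul_exp_neg_mul_Ioi hb hr)
      rw [← integral_complex_ofReal] at h5
      simp only [L]
      push_cast at h5 ⊢
      rw [h5, mul_comm, Complex.cpow_neg, one_div, Complex.ofReal_cpow (by positivity),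
        Complex.ofReal_inv, Complex.inv_cpow _ _ (by rw [Complex.arg_ofReal_of_nonneg hr.le]; exact Real.pi_pos.ne)]
    have h6 : Tendsto (fun x : ℝ => (x : ℂ)) (nhdsWithin 1 {1}ᶜ) (nhdsWithin 1 {1}ᶜ) := by
      refine tendsto_nhdsWithin_iff.2 ⟨?_, ?_⟩
      · exact (Complex.continuous_ofReal.tendsto' 1 1 (by simp)).mono_left nhdsWithin_le_nhds
      · filter_upwards [self_mem_nhdsWithin] with x hx
        simpa using hx
    refine h6.frequently (Eventually.frequently ?_)
    filter_upwards [mem_nhdsWithin_of_mem_nhds (Ioi_mem_nhds (zero_lt_one' ℝ))] with x hx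
    exact hreal x hx
  exact hEq hs

theorem brom_int (α : ℝ) (hα1 : α < 1) :
    Integrable (fun x : ℝ => (1 + x ^ 2) ^ ((α - 2) / 2)) := by
  have := integrable_rpow_neg_one_add_norm_sq (E := ℝ) (μ := volume) (r := 2 - α) (by simp; linarith)
  simpa using this

theorem brom_norm (α σ y : ℝ) (hσ : 0 < σ) :
    ‖(σ : ℂ) + y * Complex.I‖ ^ (α - 2) = σ ^ (α - 2) * (1 + (σ⁻¹ * y) ^ 2) ^ ((α - 2) / 2) := by
  have h : ‖(σ : ℂ) + y * Complex.I‖ = σ * (1 + (σ⁻¹ * y) ^ 2) ^ ((1:ℝ) / 2) := by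
    rw [Complex.norm_add_mul_I, ← Real.sqrt_eq_rpow]
    rw [show σ ^ 2 + y ^ 2 = σ ^ 2 * (1 + (σ⁻¹ * y) ^ 2) by field_simp,
      Real.sqrt_mul (by positivity), Real.sqrt_sq hσ.le]
  rw [h, Real.mul_rpow hσ.le (by positivity), ← Real.rpow_mul (by positivity)]
  congr 2
  ring

theorem brom_int2 (α σ : ℝ) (hα1 : α < 1) (hσ : 0 < σ) :
    Integrable (fun y : ℝ => ‖(σ : ℂ) + y * Complex.I‖ ^ (α - 2)) := by
  simp_rw [brom_norm α σ _ hσ]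
  exact ((integrable_comp_mul_left_iff _ (inv_ne_zero hσ.ne')).2 (brom_int α hα1)).const_mul _

theorem brom_eq (α σ : ℝ) (hα1 : α < 1) (hσ : 0 < σ) :
    ∫ y : ℝ, ‖(σ : ℂ) + y * Complex.I‖ ^ (α - 2) =
      σ ^ (α - 1) * ∫ x : ℝ, (1 + x ^ 2) ^ ((α - 2) / 2) := by
  simp_rw [brom_norm α σ _ hσ]
  rw [integral_const_mul, Measure.integral_comp_mul_left (fun x : ℝ => (1 + x ^ 2) ^ ((α - 2) / 2)),
    inv_inv, abs_of_pos hσ, smul_eq_mul, ← mul_assoc, ← Real.rpow_add_one hσ.ne']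
  congr 2
  ring

/-- shifting vertical lines -/
theorem brom_shift (α : ℝ) (hα1 : α < 1) (f : ℂ → ℂ)
    (hf : DifferentiableOn ℂ f {s | 0 < s.re}) (C : ℝ) (σ₁ σ₂ : ℝ) (h1 : 0 < σ₁) (h12 : σ₁ ≤ σ₂)
    (hC : ∀ s : ℂ, 0 < s.re → s.re ≤ σ₂ → ‖f s‖ ≤ C * ‖s‖ ^ (α - 2)) :
    ∫ y : ℝ, f (σ₁ + y * Complex.I) = ∫ y : ℝ, f (σ₂ + y * Complex.I) := by
  have hint : ∀ σ : ℝ, 0 < σ → σ ≤ σ₂ → Integrable (fun y : ℝ => f (σ + y * Complex.I)) := by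
    intro σ hσ hσ2
    refine Integrable.mono' ((brom_int2 α σ hα1 hσ).const_mul C) ?_ ?_
    · refine Continuous.aestronglyMeasurable ?_
      refine hf.continuousOn.comp_continuous (by fun_prop) ?_
      intro y; simpa using hσ
    · refine Eventually.of_forall fun y => hC _ (by simpa using hσ) (by simpa using hσ2)
  have t1 := intervalIntegral_tendsto_integral (hint σ₁ h1 h12) tendsto_neg_atTop_atBot tendsto_id
  have t2 := intervalIntegral_tendsto_integral (hint σ₂ (h1.trans_le h12) le_rfl)
    tendsto_neg_atTop_atBot tendsto_id
  have hor : ∀ ε : ℝ, |ε| = 1 → Tendsto (fun T : ℝ => ∫ x : ℝ in σ₁..σ₂, f (x + (ε * T : ℝ) * Complex.I))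
      atTop (nhds 0) := by
    intro ε hε
    have hlim : Tendsto (fun T : ℝ => (|C| * T ^ (α - 2)) * |σ₂ - σ₁|) atTop (nhds 0) := by
      have := (tendsto_rpow_neg_atTop (y := 2 - α) (by linarith)).const_mul |C| |>.mul_const |σ₂ - σ₁|
      simpa using this
    refine squeeze_zero_norm' ?_ hlim
    filter_upwards [eventually_gt_atTop 0] with T hT
    refine intervalIntegral.norm_integral_le_of_norm_le_const fun x hx => ?_
    rw [Set.uIoc_of_le h12] at hx
    have hx0 : 0 < x := h1.trans hx.1
    refine (hC _ (by simpa using hx0) (by simpa using hx.2)).trans ?_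
    refine mul_le_mul (le_abs_self C) ?_ (by positivity) (by positivity)
    refine Real.rpow_le_rpow_of_nonpos hT ?_ (by linarith)
    have := Complex.abs_im_le_norm ((x:ℂ) + (ε * T : ℝ) * Complex.I)
    simp [abs_mul, hε, abs_of_pos hT] at this
    simpa using this
  have rect : ∀ T : ℝ, 0 < T → 
      (((∫ x : ℝ in σ₁..σ₂, f (x + ((-1) * T : ℝ) * Complex.I)) -
        ∫ x : ℝ in σ₁..σ₂, f (x + (1 * T : ℝ) * Complex.I)) +
        Complex.I • ∫ y : ℝ in (-T)..T, f (σ₂ + y * Complex.I)) -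
        Complex.I • ∫ y : ℝ in (-T)..T, f (σ₁ + y * Complex.I) = 0 := by
    intro T hT
    have := Complex.integral_boundary_rect_eq_zero_of_differentiableOn f ⟨σ₁, -T⟩ ⟨σ₂, T⟩ 
      (hf.mono ?_)
    · simpa using this
    · intro z hz
      rw [Complex.mem_reProdIm] at hz
      have := hz.1
      simp only [Set.uIcc_of_le h12] at this
      exact h1.trans_le this.1
  have lim := (((hor (-1) (by simp)).sub (hor 1 (by simp))).add (t2.const_smul Complex.I)).sub
    (t1.const_smul Complex.I)
  have lim0 := lim.congr' (f₂ := fun _ => (0:ℂ)) (by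
    filter_upwards [eventually_gt_atTop 0] with T hT
    simpa using rect T hT)
  have := tendsto_nhds_unique lim0 tendsto_const_nhds
  simp only [sub_zero, zero_add, ← smul_sub, smul_eq_zero, Complex.I_ne_zero, false_or] at this
  exact (sub_eq_zero.1 this).symm

theorem brom (α : ℝ) (hα1 : α < 1) (g : ℝ → ℂ) (hg : Continuous g)
    (hg0 : ∀ t ≤ 0, g t = 0) (H : ℂ → ℂ) (hH : DifferentiableOn ℂ H {s | 0 < s.re}) (C : ℝ)
    (hC : ∀ s : ℂ, 0 < s.re → ‖H s‖ ≤ C * ‖s‖ ^ (α - 2)) (σ₁ : ℝ) (hσ₁ : 0 < σ₁)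
    (hint : IntegrableOn (fun t : ℝ => Complex.exp (-(σ₁ * t)) * g t) (Set.Ioi 0))
    (hL : ∀ s : ℂ, s.re = σ₁ → ∫ t : ℝ in Set.Ioi 0, Complex.exp (-(s * t)) * g t = H s) :
    ∃ K : ℝ, ∀ t > 0, ‖g t‖ ≤ K * t ^ (1 - α) := by
  have hC0 : 0 ≤ C := by
    have := (norm_nonneg _).trans (hC 1 (by simp))
    simpa using this
  set φ : ℝ → ℂ := fun t => Complex.exp (-(σ₁ * t)) * g t with hφ
  have hφc : Continuous φ := by fun_prop
  have hφ0 : ∀ t, t ∉ Set.Ioi (0:ℝ) → φ t = 0 := by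
    intro t ht
    simp [hφ, hg0 t (by simpa using ht)]
  have hφi : Integrable φ := by
    rw [← integrableOn_iff_integrable_of_support_subset (s := Set.Ioi 0)]
    · exact hint
    · intro t ht
      by_contra h
      exact ht (hφ0 t h)
  have hF : FourierTransform.fourier φ = fun ξ : ℝ => H (σ₁ + (2 * Real.pi * ξ : ℝ) * Complex.I) := by
    ext ξ
    rw [Real.fourier_real_eq_integral_exp_smul, ← hL _ (by simp),
      ← setIntegral_eq_integral_of_forall_compl_eq_zero (s := Set.Ioi 0)]
    · refine integral_congr_ae (Eventually.of_forall fun t => ?_)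
      simp only [hφ, smul_eq_mul]
      rw [← mul_assoc, ← Complex.exp_add]
      congr 2
      push_cast
      ring
    · intro t ht
      simp [hφ0 t ht]
  have hHi : Integrable (fun y : ℝ => H (σ₁ + y * Complex.I)) := by
    refine Integrable.mono' ((brom_int2 α σ₁ hα1 hσ₁).const_mul C) ?_ ?_
    · refine Continuous.aestronglyMeasurable ?_
      refine hH.continuousOn.comp_continuous (by fun_prop) ?_
      intro y; simpa using hσ₁
    · exact Eventually.of_forall fun y => hC _ (by simpa using hσ₁)
  have hFi : Integrable (FourierTransform.fourier φ) := by
    rw [hF]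
    exact (integrable_comp_mul_left_iff (fun y : ℝ => H (σ₁ + y * Complex.I))
      (by positivity : (2 * Real.pi) ≠ 0)).2 hHi
  have hinv : ∀ t : ℝ, g t = (2 * Real.pi : ℝ)⁻¹ * ∫ y : ℝ, 
      Complex.exp ((σ₁ + y * Complex.I) * t) * H (σ₁ + y * Complex.I) := by
    intro t
    have h1 := congrFun (hφc.fourierInv_fourier_eq hφi hFi) t
    rw [hF, Real.fourierInv_eq'] at h1
    have h2 := Measure.integral_comp_mul_left (fun y : ℝ => 
      Complex.exp ((σ₁ + y * Complex.I) * t) * H (σ₁ + y * Complex.I)) (2 * Real.pi)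
    rw [abs_of_pos (by positivity)] at h2
    have h3 : g t = Complex.exp (σ₁ * t) * φ t := by
      simp only [hφ]
      rw [← mul_assoc, ← Complex.exp_add]
      simp
    rw [h3, ← h1, ← integral_const_mul]
    rw [Complex.real_smul] at h2
    rw [← h2]
    refine integral_congr_ae (Eventually.of_forall fun ξ => ?_)
    simp only [smul_eq_mul]
    rw [← mul_assoc, ← Complex.exp_add]
    congr 2
    simp
    ring
  set K0 := ∫ x : ℝ, (1 + x ^ 2) ^ ((α - 2) / 2)
  have final : ∀ t : ℝ, 0 < t → ∀ σ : ℝ, 0 < σ → σ * t = 1 → ‖∫ y : ℝ, Complex.exp ((σ + y * Complex.I) * t) * H (σ + y * Complex.I)‖ ≤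
      (Real.exp 1 * C * K0) * t ^ (1 - α) := by
    intro t ht σ hσ hσt
    calc _ ≤ ∫ y : ℝ, (Real.exp 1 * C) * ‖(σ : ℂ) + y * Complex.I‖ ^ (α - 2) := by
          refine norm_integral_le_of_norm_le ((brom_int2 α σ hα1 hσ).const_mul _) 
            (Eventually.of_forall fun y => ?_)
          rw [norm_mul, Complex.norm_exp, mul_assoc]
          refine mul_le_mul (le_of_eq ?_) (hC _ (by simpa using hσ)) (norm_nonneg _) (by positivity)
          simp [hσt]
      _ = _ := by
          rw [integral_const_mul, brom_eq α σ hα1 hσ]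
          have : σ = t⁻¹ := eq_inv_of_mul_eq_one_left hσt
          rw [this, Real.inv_rpow ht.le, ← Real.rpow_neg ht.le, neg_sub]
          ring
  refine ⟨(2 * Real.pi)⁻¹ * (Real.exp 1 * C * K0), fun t ht => ?_⟩
  have hd : DifferentiableOn ℂ (fun s => Complex.exp (s * t) * H s) {s | 0 < s.re} :=
    DifferentiableOn.mul (by fun_prop) hH
  have hb : ∀ σ₂ : ℝ, ∀ s : ℂ, 0 < s.re → s.re ≤ σ₂ → 
      ‖(fun s => Complex.exp (s * t) * H s) s‖ ≤ (Real.exp (σ₂ * t) * C) * ‖s‖ ^ (α - 2) := by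
    intro σ₂ s hs hs2
    simp only
    rw [norm_mul, Complex.norm_exp, mul_assoc]
    refine mul_le_mul ?_ (hC _ hs) (norm_nonneg _) (by positivity)
    simp
    gcongr
  have hσ : 0 < t⁻¹ := inv_pos.2 ht
  have hshift : ∫ y : ℝ, Complex.exp ((σ₁ + y * Complex.I) * t) * H (σ₁ + y * Complex.I) = 
     ∫ y : ℝ, Complex.exp (((t⁻¹ : ℝ) + y * Complex.I) * t) * H ((t⁻¹ : ℝ) + y * Complex.I) := by
    rcases le_total σ₁ t⁻¹ with h | h
    · exact brom_shift α hα1 _ hd _ σ₁ t⁻¹ hσ₁ h (hb _)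
    · exact (brom_shift α hα1 _ hd _ t⁻¹ σ₁ hσ h (hb _)).symm
  rw [hinv t, hshift, norm_mul, Complex.norm_real, Real.norm_of_nonneg (by positivity), mul_assoc]
  gcongr
  exact final t ht _ hσ (inv_mul_cancel₀ ht.ne')

theorem integrable_tsum_aux {F : ℕ → ℝ → ℂ} {G : ℝ → ℂ} {μ : Measure ℝ}
    (hG : AEStronglyMeasurable G μ) (hFG : ∀ᵐ t ∂μ, G t = ∑' j, F j t)
    (hF_int : ∀ i, Integrable (F i) μ) (hF_sum : Summable fun i ↦ ∫ a, ‖F i a‖ ∂μ) :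
    Integrable G μ := by
  refine ⟨hG, ?_⟩
  have h1 : ∫⁻ t, ‖G t‖ₑ ∂μ ≤ ∑' i, ∫⁻ t, ‖F i t‖ₑ ∂μ := by
    rw [← lintegral_tsum fun i => (hF_int i).1.enorm]
    refine lintegral_mono_ae ?_
    filter_upwards [hFG] with t ht
    rw [ht]
    exact enorm_tsum_le_tsum_enorm
  refine lt_of_le_of_lt h1 ?_
  have h2 : ∀ i, ∫⁻ t, ‖F i t‖ₑ ∂μ = ENNReal.ofReal (∫ t, ‖F i t‖ ∂μ) := fun i =>
    (ofReal_integral_norm_eq_lintegral_enorm (hF_int i)).symm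
  simp_rw [h2]
  exact hF_sum.tsum_ofReal_lt_top

theorem series_laplace (α β δ : ℝ) (hα : 0 < α) (hβ : 0 < β) (hδ : 0 < δ) (p : ℕ → ℝ)
    (hp : ∀ j : ℕ, Real.Gamma (α * j + δ + 1) = p j * Real.Gamma (α * j + β))
    (hps : ∀ r : ℝ, 0 ≤ r → r < 1 → Summable (fun j => p j * r ^ j)) (a s : ℂ)
    (hs : 0 < s.re) (hsa : ‖a‖ < s.re ^ α) :
    IntegrableOn (fun t : ℝ => Complex.exp (-(s * t)) *
      (((t ^ δ : ℝ) : ℂ) * ML α β (a * ((t ^ α : ℝ) : ℂ)))) (Set.Ioi 0) ∧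
    ∫ t : ℝ in Set.Ioi 0, Complex.exp (-(s * t)) *
      (((t ^ δ : ℝ) : ℂ) * ML α β (a * ((t ^ α : ℝ) : ℂ))) =
      (∑' j : ℕ, (p j : ℂ) * (a * s ^ (-(α : ℂ))) ^ j) * s ^ (-((δ : ℂ) + 1)) := by
  set F : ℕ → ℝ → ℂ := fun j t => (a ^ j / (Real.Gamma (α * j + β) : ℂ)) *
    (((t ^ ((α * j + δ + 1) - 1) : ℝ) : ℂ) * Complex.exp (-(s * t))) with hF
  have hs0 : s ≠ 0 := by rintro rfl; simp at hs
  have hpos : ∀ j : ℕ, 0 < α * j + δ + 1 := fun j => by positivity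
  have hgp : ∀ j : ℕ, 0 < Real.Gamma (α * j + β) := fun j => Real.Gamma_pos_of_pos (by positivity)
  have hFi : ∀ j, IntegrableOn (F j) (Set.Ioi 0) := fun j =>
    (laplace_integrable _ (hpos j) s hs).const_mul _
  have hFn : ∀ j, ∫ t in Set.Ioi 0, ‖F j t‖ = p j * (‖a‖ / s.re ^ α) ^ j * (1 / s.re) ^ (δ + 1) := by
    intro j
    have h1 : ∫ t in Set.Ioi 0, ‖F j t‖ = ∫ t in Set.Ioi 0, (‖a‖ ^ j / Real.Gamma (α * j + β)) *
        (t ^ ((α * j + δ + 1) - 1) * Real.exp (-(s.re * t))) := by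
      refine setIntegral_congr_fun measurableSet_Ioi fun t ht => ?_
      have ht' : 0 < t := ht
      simp only [hF]
      rw [norm_mul, norm_mul, Complex.norm_exp, Complex.norm_real, norm_div, norm_pow,
        Complex.norm_real, Real.norm_of_nonneg (hgp j).le, Real.norm_of_nonneg (by positivity)]
      simp
    rw [h1, integral_const_mul, Real.integral_rpow_mul_exp_neg_mul_Ioi (hpos j) hs, hp j]
    have h2 : (1 / s.re) ^ (α * j + δ + 1) = ((1 / s.re) ^ α) ^ j * (1 / s.re) ^ (δ + 1) := by
      rw [← Real.rpow_mul_natCast (by positivity), ← Real.rpow_add (by positivity)]; congr 1; ring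
    rw [h2, div_pow, Real.div_rpow zero_le_one hs.le, Real.one_rpow, one_div, inv_pow]
    have := (hgp j).ne'
    have h5 : (s.re ^ α) ^ j ≠ 0 := by positivity
    field_simp
  have hFs : Summable fun j => ∫ t in Set.Ioi 0, ‖F j t‖ := by
    simp_rw [hFn]
    exact (hps _ (by positivity) (by rw [div_lt_one (by positivity)]; exact hsa)).mul_right _
  have hFt : ∀ t ∈ Set.Ioi (0:ℝ), Complex.exp (-(s * t)) *
      (((t ^ δ : ℝ) : ℂ) * ML α β (a * ((t ^ α : ℝ) : ℂ))) = ∑' j, F j t := by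
    intro t ht
    have ht' : 0 < t := ht
    rw [ML, ← mul_assoc, ← tsum_mul_left]
    refine tsum_congr fun j => ?_
    simp only [hF]
    have h3 : t ^ ((α * j + δ + 1) - 1) = t ^ δ * (t ^ α) ^ j := by
      rw [← Real.rpow_mul_natCast ht'.le, ← Real.rpow_add ht']; congr 1; ring
    rw [h3]
    push_cast
    ring
  constructor
  · refine integrable_tsum_aux ?_ ?_ hFi hFs
    · refine ContinuousOn.aestronglyMeasurable ?_ measurableSet_Ioi
      have hc : ∀ r : ℝ, ContinuousOn (fun t : ℝ => ((t ^ r : ℝ) : ℂ)) (Set.Ioi 0) := fun r =>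
        Complex.continuous_ofReal.comp_continuousOn fun t ht =>
          (Real.continuousAt_rpow_const _ _ (Or.inl (ne_of_gt ht))).continuousWithinAt
      refine ContinuousOn.mul (by fun_prop) ((hc δ).mul ?_)
      exact (ml_continuous α β hα hβ).comp_continuousOn (continuousOn_const.mul (hc α))
    · filter_upwards [ae_restrict_mem measurableSet_Ioi] with t ht
      exact hFt t ht
  · rw [setIntegral_congr_fun measurableSet_Ioi hFt,
      ← integral_tsum_of_summable_integral_norm hFi hFs, ← tsum_mul_right]
    refine tsum_congr fun j => ?_
    simp only [hF]
    rw [integral_const_mul, laplace_pow _ (hpos j) s hs, hp j]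
    have h4 : s ^ (-((α * j + δ + 1 : ℝ) : ℂ)) = (s ^ (-(α:ℂ))) ^ j * s ^ (-((δ : ℂ) + 1)) := by
      rw [← Complex.cpow_mul_nat, ← Complex.cpow_add _ _ hs0]; congr 1; push_cast; ring
    rw [h4]
    have : (Real.Gamma (α * j + β) : ℂ) ≠ 0 := by exact_mod_cast (hgp j).ne'
    push_cast
    rw [mul_pow]
    field_simp

theorem ml_decay (α β δ : ℝ) (hα : 0 < α) (hα1 : α < 1) (hβ : 0 < β) (hδ : 0 < δ) (p : ℕ → ℝ)
    (hp : ∀ j : ℕ, Real.Gamma (α * j + δ + 1) = p j * Real.Gamma (α * j + β))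
    (hps : ∀ r : ℝ, 0 ≤ r → r < 1 → Summable (fun j => p j * r ^ j)) (a : ℂ) (ha : a ≠ 0)
    (harg : α * Real.pi / 2 < |Complex.arg a|) (P : ℂ → ℂ) (hPd : Differentiable ℂ P)
    (hP : ∀ s : ℂ, 0 < s.re → ‖a * s ^ (-(α : ℂ))‖ < 1 →
      (∑' j : ℕ, (p j : ℂ) * (a * s ^ (-(α : ℂ))) ^ j) * s ^ (-((δ : ℂ) + 1)) =
        s ^ ((α : ℂ) - 2) * P ((s ^ (α : ℂ) - a)⁻¹)) :
    ∃ K : ℝ, ∀ t > 0, ‖((t ^ δ : ℝ) : ℂ) * ML α β (a * ((t ^ α : ℝ) : ℂ))‖ ≤ K * t ^ (1 - α) := by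
  obtain ⟨ε, hε, hgap⟩ := sector_gap α hα hα1.le a ha harg
  obtain ⟨C, hC⟩ := (isCompact_closedBall (0:ℂ) (ε⁻¹)).exists_bound_of_continuousOn
    hPd.continuous.continuousOn
  obtain ⟨σ, hσa, hσ⟩ := (((tendsto_rpow_atTop hα).eventually_gt_atTop ‖a‖).and
    (eventually_gt_atTop 0)).exists
  set g : ℝ → ℂ := fun t => (((max t 0) ^ δ : ℝ) : ℂ) * ML α β (a * (((max t 0) ^ α : ℝ) : ℂ)) with hg
  have hgt : ∀ t ∈ Set.Ioi (0:ℝ), g t = ((t ^ δ : ℝ) : ℂ) * ML α β (a * ((t ^ α : ℝ) : ℂ)) := by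
    intro t ht
    have ht' : 0 ≤ t := le_of_lt (Set.mem_Ioi.1 ht)
    simp only [hg, max_eq_left ht']
  have hne : ∀ s : ℂ, 0 < s.re → s ^ (α : ℂ) - a ≠ 0 := fun s hs h => by
    have := hgap s hs
    rw [h, norm_zero] at this
    linarith
  have hlap := fun (s : ℂ) (hs : s.re = σ) => series_laplace α β δ hα hβ hδ p hp hps a s
    (by rw [hs]; exact hσ) (by rw [hs]; exact hσa)
  suffices hmain : ∃ K : ℝ, ∀ t > 0, ‖g t‖ ≤ K * t ^ (1 - α) by
    obtain ⟨K, hK⟩ := hmain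
    refine ⟨K, fun t ht => ?_⟩
    rw [← hgt t ht]
    exact hK t ht
  refine brom α hα1 g ?_ ?_ (fun s => s ^ ((α : ℂ) - 2) * P ((s ^ (α : ℂ) - a)⁻¹)) ?_ C ?_
    σ hσ ?_ ?_
  · have hc : ∀ r : ℝ, 0 < r → Continuous (fun t : ℝ => (((max t 0) ^ r : ℝ) : ℂ)) := fun r hr =>
      Complex.continuous_ofReal.comp
        ((Real.continuous_rpow_const hr.le).comp (continuous_id.max continuous_const))
    exact (hc δ hδ).mul ((ml_continuous α β hα hβ).comp (continuous_const.mul (hc α hα)))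
  · intro t ht
    simp [hg, max_eq_right ht, Real.zero_rpow hδ.ne']
  · intro s hs
    have hsl : s ∈ Complex.slitPlane := Or.inl hs
    refine DifferentiableAt.differentiableWithinAt ?_
    refine DifferentiableAt.mul (DifferentiableAt.cpow_const differentiableAt_id hsl) ?_
    refine hPd.differentiableAt.comp s (DifferentiableAt.inv ?_ (hne s hs))
    exact (DifferentiableAt.cpow_const differentiableAt_id hsl).sub_const _
  · intro s hs
    have h1 : ‖s ^ ((α : ℂ) - 2)‖ = ‖s‖ ^ (α - 2) := by
      rw [← Complex.norm_cpow_real]; push_cast; rfl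
    rw [norm_mul, h1, mul_comm]
    refine mul_le_mul_of_nonneg_right (hC _ ?_) (by positivity)
    rw [mem_closedBall_zero_iff, norm_inv]
    exact inv_anti₀ hε (hgap s hs)
  · refine (hlap σ (by simp)).1.congr_fun (fun t ht => ?_) measurableSet_Ioi
    simp only [hgt t ht]
  · intro s hs
    have hs' : 0 < s.re := by rw [hs]; exact hσ
    rw [← hP s hs', ← (hlap s hs).2]
    · refine setIntegral_congr_fun measurableSet_Ioi (fun t ht => ?_)
      simp only [hgt t ht]
    · have h2 : ‖s ^ (-(α:ℂ))‖ = (‖s‖ ^ α)⁻¹ := by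
        rw [Complex.cpow_neg, norm_inv, Complex.norm_cpow_real]
      have h3 : σ ≤ ‖s‖ := by rw [← hs]; exact Complex.re_le_norm s
      rw [norm_mul, h2, ← div_eq_mul_inv, div_lt_one (Real.rpow_pos_of_pos (hσ.trans_le h3) _)]
      exact hσa.trans_le (by gcongr)

theorem ml_one_decay (α : ℝ) (hα : 0 < α) (hα1 : α < 1) (a : ℂ) (ha : a ≠ 0)
    (harg : α * Real.pi / 2 < |Complex.arg a|) :
    ∃ K : ℝ, ∀ t > 0, ‖((t ^ (1:ℝ) : ℝ) : ℂ) * ML α 1 (a * ((t ^ α : ℝ) : ℂ))‖ ≤ K * t ^ (1 - α) := by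
  obtain ⟨ε, hε, hgap⟩ := sector_gap α hα hα1.le a ha harg
  refine ml_decay α 1 1 hα hα1 one_pos one_pos (fun j => α * j + 1) ?_ ?_ a ha harg
    (fun q => α * a * q ^ 2 + q) (by fun_prop) ?_
  · intro j
    rw [Real.Gamma_add_one (by positivity)]
  · intro r hr0 hr1
    have h := ((hasSum_coe_mul_geometric_of_norm_lt_one
      (by rwa [Real.norm_of_nonneg hr0] : ‖r‖ < 1)).summable.mul_left α).add
      (summable_geometric_of_lt_one hr0 hr1)
    refine h.congr fun j => by ring
  · intro s hs hq
    have hs0 : s ≠ 0 := by rintro rfl; simp at hs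
    have h := ((hasSum_coe_mul_geometric_of_norm_lt_one hq).mul_left (α : ℂ)).add
      (hasSum_geometric_of_norm_lt_one hq)
    have h1 := h.tsum_eq
    rw [← tsum_congr (f := fun j : ℕ => ((α * j + 1 : ℝ) : ℂ) * (a * s ^ (-(α : ℂ))) ^ j) fun j => by
      push_cast; ring] at h1
    rw [h1]
    have hne : s ^ (α : ℂ) - a ≠ 0 := fun h => by
      have := hgap s hs
      rw [h, norm_zero] at this
      linarith
    have hw : s ^ (α:ℂ) ≠ 0 := by simp [Complex.cpow_eq_zero_iff, hs0]
    rw [Complex.cpow_neg, Complex.cpow_neg, show ((1:ℝ):ℂ) + 1 = (2:ℕ) by norm_num,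
      Complex.cpow_sub _ _ hs0, show (2:ℂ) = ((2:ℕ):ℂ) by norm_num, Complex.cpow_natCast]
    generalize s ^ (α : ℂ) = w at *
    have h2 : 1 - a * w⁻¹ = (w - a) * w⁻¹ := by field_simp
    rw [h2]
    field_simp

theorem ml_ker_decay (α : ℝ) (hα : 0 < α) (hα1 : α < 1) (a : ℂ) (ha : a ≠ 0)
    (harg : α * Real.pi / 2 < |Complex.arg a|) :
    ∃ K : ℝ, ∀ t > 0, ‖((t ^ (α + 1) : ℝ) : ℂ) * ML α α (a * ((t ^ α : ℝ) : ℂ))‖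
      ≤ K * t ^ (1 - α) := by
  obtain ⟨ε, hε, hgap⟩ := sector_gap α hα hα1.le a ha harg
  refine ml_decay α α (α + 1) hα hα1 hα (by linarith)
    (fun j => (α * j + α + 1) * (α * j + α)) ?_ ?_ a ha harg
    (fun q => 2 * α ^ 2 * q ^ 2 * (1 + a * q) + (α - α ^ 2) * q ^ 2) (by fun_prop) ?_
  · intro j
    rw [Real.Gamma_add_one (by positivity), ← add_assoc, Real.Gamma_add_one (by positivity)]
    ring
  · intro r hr0 hr1
    have hr : ‖r‖ < 1 := by rwa [Real.norm_of_nonneg hr0]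
    have h := ((hasSum_choose_mul_geometric_of_norm_lt_one 2 hr).summable.mul_left (2 * α ^ 2)).add
      ((hasSum_choose_mul_geometric_of_norm_lt_one 1 hr).summable.mul_left (α - α ^ 2))
    refine h.congr fun j => ?_
    rw [Nat.cast_choose_two, Nat.choose_one_right]
    push_cast
    ring
  · intro s hs hq
    have hs0 : s ≠ 0 := by rintro rfl; simp at hs
    have h := ((hasSum_choose_mul_geometric_of_norm_lt_one 2 hq).mul_left (2 * (α:ℂ) ^ 2)).add
      ((hasSum_choose_mul_geometric_of_norm_lt_one 1 hq).mul_left ((α : ℂ) - α ^ 2))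
    have h1 := h.tsum_eq
    rw [← tsum_congr (f := fun j : ℕ => (((α * j + α + 1) * (α * j + α) : ℝ) : ℂ) *
        (a * s ^ (-(α : ℂ))) ^ j) fun j => by
      rw [Nat.cast_choose_two, Nat.choose_one_right]
      push_cast
      ring] at h1
    rw [h1]
    have hne : s ^ (α : ℂ) - a ≠ 0 := fun h => by
      have := hgap s hs
      rw [h, norm_zero] at this
      linarith
    have hw : s ^ (α:ℂ) ≠ 0 := by simp [Complex.cpow_eq_zero_iff, hs0]
    rw [Complex.cpow_neg, Complex.cpow_neg, show (((α + 1:ℝ):ℂ) + 1) = α + (2:ℕ) by push_cast; ring,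
      Complex.cpow_add _ _ hs0,
      Complex.cpow_sub _ _ hs0, show (2:ℂ) = ((2:ℕ):ℂ) by norm_num, Complex.cpow_natCast]
    generalize s ^ (α : ℂ) = w at *
    have h2 : 1 - a * w⁻¹ = (w - a) / w := by field_simp
    simp only [h2, div_pow, one_div_div, Nat.reduceAdd]
    field_simp
    ring

theorem ml_one_one (z : ℂ) : ML 1 1 z = Complex.exp z := by
  rw [Complex.exp_eq_exp_ℂ, NormedSpace.exp_eq_tsum_div, ML]
  refine tsum_congr fun j => ?_
  rw [one_mul, Real.Gamma_nat_eq_factorial]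
  simp

theorem re_neg_of_arg (a : ℂ) (harg : 1 * Real.pi / 2 < |Complex.arg a|) : a.re < 0 := by
  by_contra h
  push Not at h
  have := Complex.abs_arg_le_pi_div_two_iff.2 h
  linarith

theorem ml_one_tendsto (α : ℝ) (hα : 0 < α) (hα1 : α ≤ 1) (a : ℂ) (ha : a ≠ 0)
    (harg : α * Real.pi / 2 < |Complex.arg a|) :
    Tendsto (fun t : ℝ => ML α 1 (a * ((t ^ α : ℝ) : ℂ))) atTop (nhds 0) := by
  rcases hα1.lt_or_eq with h1 | rfl
  · obtain ⟨K, hK⟩ := ml_one_decay α hα h1 a ha harg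
    have hlim : Tendsto (fun t : ℝ => K * t ^ (-α)) atTop (nhds 0) := by
      simpa using (tendsto_rpow_neg_atTop hα).const_mul K
    refine squeeze_zero_norm' ?_ hlim
    filter_upwards [eventually_gt_atTop 0] with t ht
    have h := hK t ht
    rw [norm_mul, Complex.norm_real, Real.rpow_one, Real.norm_of_nonneg ht.le] at h
    have h2 : t ^ (1 - α) = t * t ^ (-α) := by
      rw [sub_eq_add_neg, Real.rpow_add ht, Real.rpow_one]
    rw [h2] at h
    refine le_of_mul_le_mul_left ?_ ht
    linarith
  · have hre := re_neg_of_arg a harg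
    simp_rw [ml_one_one, Real.rpow_one]
    rw [tendsto_zero_iff_norm_tendsto_zero]
    simp_rw [Complex.norm_exp]
    refine Real.tendsto_exp_atBot.comp ?_
    simp only [Complex.mul_re, Complex.ofReal_re, Complex.ofReal_im, mul_zero, sub_zero]
    exact tendsto_id.const_mul_atTop_of_neg hre

theorem ker_contOn (α : ℝ) (hα : 0 < α) (a : ℂ) :
    ContinuousOn (fun t : ℝ => ((t ^ (α - 1) : ℝ) : ℂ) * ML α α (a * ((t ^ α : ℝ) : ℂ)))
      (Set.Ioi 0) := by
  have hc : ∀ r : ℝ, ContinuousOn (fun t : ℝ => ((t ^ r : ℝ) : ℂ)) (Set.Ioi 0) := fun r =>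
    Complex.continuous_ofReal.comp_continuousOn fun t ht =>
      (Real.continuousAt_rpow_const _ _ (Or.inl (ne_of_gt ht))).continuousWithinAt
  exact (hc _).mul ((ml_continuous α α hα hα).comp_continuousOn (continuousOn_const.mul (hc α)))

theorem ker_integrable_s16 (α : ℝ) (hα : 0 < α) (hα1 : α ≤ 1) (a : ℂ) (ha : a ≠ 0)
    (harg : α * Real.pi / 2 < |Complex.arg a|) :
    IntegrableOn (fun t : ℝ => ((t ^ (α - 1) : ℝ) : ℂ) * ML α α (a * ((t ^ α : ℝ) : ℂ)))
      (Set.Ioi 0) := by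
  rcases hα1.lt_or_eq with h1 | rfl
  · obtain ⟨K, hK⟩ := ml_ker_decay α hα h1 a ha harg
    rw [← Set.Ioc_union_Ioi_eq_Ioi (zero_le_one' ℝ)]
    refine IntegrableOn.union ?_ ?_
    · have hcont : Continuous (fun t : ℝ => ML α α (a * ((t ^ α : ℝ) : ℂ))) :=
        (ml_continuous α α hα hα).comp (continuous_const.mul
          (Complex.continuous_ofReal.comp (Real.continuous_rpow_const hα.le)))
      obtain ⟨M, hM⟩ := (isCompact_Icc (a := (0:ℝ)) (b := 1)).exists_bound_of_continuousOn
        hcont.continuousOn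
      have hi : IntegrableOn (fun t : ℝ => t ^ (α - 1)) (Set.Ioc 0 1) :=
        (intervalIntegrable_iff_integrableOn_Ioc_of_le zero_le_one).1
          (intervalIntegral.intervalIntegrable_rpow' (by linarith))
      refine Integrable.mono' (hi.mul_const M)
        (((ker_contOn α hα a).mono fun t ht => ht.1).aestronglyMeasurable measurableSet_Ioc) ?_
      filter_upwards [ae_restrict_mem measurableSet_Ioc] with t ht
      have ht0 : 0 < t := ht.1
      rw [norm_mul, Complex.norm_real, Real.norm_of_nonneg (by positivity)]
      exact mul_le_mul_of_nonneg_left (hM t ⟨ht0.le, ht.2⟩) (by positivity)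
    · have hi := (integrableOn_Ioi_rpow_of_lt (a := -1 - α) (by linarith) one_pos).const_mul K
      refine Integrable.mono' hi (((ker_contOn α hα a).mono
        (Set.Ioi_subset_Ioi zero_le_one)).aestronglyMeasurable measurableSet_Ioi) ?_
      filter_upwards [ae_restrict_mem measurableSet_Ioi] with t ht
      have ht0 : 0 < t := zero_lt_one.trans ht
      have h := hK t ht0
      rw [norm_mul, Complex.norm_real, Real.norm_of_nonneg (by positivity)] at h ⊢
      have e1 : t ^ (α + 1) = t ^ (2:ℝ) * t ^ (α - 1) := by
        rw [← Real.rpow_add ht0]; congr 1; ring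
      have e2 : t ^ (1 - α) = t ^ (2:ℝ) * t ^ (-1 - α) := by
        rw [← Real.rpow_add ht0]; congr 1; ring
      rw [e1, e2] at h
      refine le_of_mul_le_mul_left ?_ (by positivity : 0 < t ^ (2:ℝ))
      linarith
  · have hre := re_neg_of_arg a harg
    simp_rw [ml_one_one, Real.rpow_one, sub_self, Real.rpow_zero, Complex.ofReal_one, one_mul]
    refine Integrable.mono' (exp_neg_integrableOn_Ioi 0 (by linarith : 0 < -a.re))
      (by fun_prop) (Eventually.of_forall fun t => ?_)
    rw [Complex.norm_exp]
    simp

theorem conv_tendsto_s16 (k x : ℝ → ℂ) (hk : IntegrableOn k (Set.Ioi 0)) (hx : Continuous x)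
    (hx0 : Tendsto x atTop (nhds 0)) :
    Tendsto (fun t : ℝ => ∫ s in (0:ℝ)..t, k (t - s) * x s) atTop (nhds 0) := by
  obtain ⟨M, hM⟩ : ∃ M : ℝ, ∀ t ≥ 0, ‖x t‖ ≤ M := by
    have h1 : ∀ᶠ t in atTop, ‖x t‖ < 1 := by
      have := hx0.norm
      rw [norm_zero] at this
      exact this.eventually_lt_const zero_lt_one
    obtain ⟨T, hT⟩ := eventually_atTop.1 h1
    obtain ⟨M, hM⟩ := (isCompact_Icc (a := (0:ℝ)) (b := T)).exists_bound_of_continuousOn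
      hx.continuousOn
    refine ⟨max M 1, fun t ht => ?_⟩
    rcases le_total t T with h | h
    · exact (hM t ⟨ht, h⟩).trans (le_max_left _ _)
    · exact (hT t h).le.trans (le_max_right _ _)
  have hM0 : 0 ≤ M := (norm_nonneg _).trans (hM 0 le_rfl)
  set F : ℝ → ℝ → ℂ := fun t => (Set.Iic t).indicator fun u => k u * x (t - u) with hF
  have hD : Tendsto (fun t => ∫ u in Set.Ioi 0, F t u) atTop
      (nhds (∫ u in Set.Ioi (0:ℝ), (0:ℂ))) := by
    refine tendsto_integral_filter_of_dominated_convergence (fun u => ‖k u‖ * M) ?_ ?_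
      (hk.norm.mul_const M) ?_
    · refine Eventually.of_forall fun t => ?_
      refine AEStronglyMeasurable.indicator ?_ measurableSet_Iic
      exact hk.1.mul (by fun_prop : Continuous fun u => x (t - u)).aestronglyMeasurable
    · refine Eventually.of_forall fun t => Eventually.of_forall fun u => ?_
      simp only [hF, Set.indicator_apply, Set.mem_Iic]
      split_ifs with h
      · rw [norm_mul]
        exact mul_le_mul_of_nonneg_left (hM _ (by linarith)) (norm_nonneg _)
      · rw [norm_zero]; positivity
    · refine Eventually.of_forall fun u => ?_
      have h2 : Tendsto (fun t => k u * x (t - u)) atTop (nhds 0) := by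
        have := (hx0.comp (tendsto_atTop_add_const_right atTop (-u) tendsto_id)).const_mul (k u)
        simpa [Function.comp_def, sub_eq_add_neg] using this
      refine h2.congr' ?_
      filter_upwards [eventually_ge_atTop u] with t ht
      simp [hF, ht]
  rw [integral_zero] at hD
  refine hD.congr' ?_
  filter_upwards [eventually_ge_atTop 0] with t ht
  have h3 := intervalIntegral.integral_comp_sub_left (a := 0) (b := t)
    (fun u => k u * x (t - u)) t
  simp only [sub_sub_cancel, sub_self, sub_zero] at h3
  rw [h3, intervalIntegral.integral_of_le ht, setIntegral_indicator measurableSet_Iic,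
    Set.Ioi_inter_Iic]

theorem stmt_16
    (α₁ α₂ : ℝ) (hα₁ : α₁ ∈ Set.Ioc (0 : ℝ) 1) (hα₂ : α₂ ∈ Set.Ioc (0 : ℝ) 1)
    (a₁₁ a₂₂ : ℂ) (ha₁₁ : a₁₁ ≠ 0) (ha₂₂ : a₂₂ ≠ 0) (a₁₂ : ℂ)
    (harg₁ : α₁ * Real.pi / 2 < |Complex.arg a₁₁|)
    (harg₂ : α₂ * Real.pi / 2 < |Complex.arg a₂₂|)
    (x₁₀ x₂₀ : ℂ)
    (x₂ : ℝ → ℂ)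
    (hx₂ : ∀ t : ℝ, x₂ t = x₂₀ * ML α₂ 1 (a₂₂ * ((t ^ α₂ : ℝ) : ℂ)))
    (x₁ : ℝ → ℂ)
    (hx₁ : ∀ t : ℝ,
      x₁ t = x₁₀ * ML α₁ 1 (a₁₁ * ((t ^ α₁ : ℝ) : ℂ)) +
        a₁₂ * ∫ s in (0 : ℝ)..t,
          (((t - s) ^ (α₁ - 1) : ℝ) : ℂ) * ML α₁ α₁ (a₁₁ * (((t - s) ^ α₁ : ℝ) : ℂ)) * x₂ s) :
    Tendsto x₂ atTop (nhds 0) ∧ Tendsto x₁ atTop (nhds 0) := by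
  have h2 : Tendsto x₂ atTop (nhds 0) := by
    rw [funext hx₂]
    simpa using (ml_one_tendsto α₂ hα₂.1 hα₂.2 a₂₂ ha₂₂ harg₂).const_mul x₂₀
  have h2c : Continuous x₂ := by
    rw [funext hx₂]
    exact continuous_const.mul ((ml_continuous α₂ 1 hα₂.1 one_pos).comp (continuous_const.mul
      (Complex.continuous_ofReal.comp (Real.continuous_rpow_const hα₂.1.le))))
  refine ⟨h2, ?_⟩
  rw [funext hx₁]
  have h3 := conv_tendsto_s16 _ x₂ (ker_integrable_s16 α₁ hα₁.1 hα₁.2 a₁₁ ha₁₁ harg₁) h2c h2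
  have h4 := ((ml_one_tendsto α₁ hα₁.1 hα₁.2 a₁₁ ha₁₁ harg₁).const_mul x₁₀).add
    (h3.const_mul a₁₂)
  simpa using h4
end
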